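/- arXiv:1404.3409 — 2 statements merged into one kernel-verified Lean document; each statement's English description precedes it below -/
import Mathlib

section
/- Endow the space 𝔽 of formal power series over ℂ with the metric d̃ given by d̃((a_k),(b_k)) = 2^{−j} where j is the smallest index with a_j ≠ b_j (and d̃ = 0 if the series are equal); this is the product topology where each copy of ℂ carries the discrete topology, and (𝔽, d̃) is a complete metric space. Let 𝒮=(m_k,n_k)_{k≥0} be a sequence of pairs of positive integers such that (m_k)_{k≥0} is unbounded. Then the set of power series f ∈ 𝔽 such that there exists an infinite set I ⊂ ℕ with f ∈ 𝒟_{m_k,n_k} for all k ∈ I and the set of poles of the Padé approximants [f; m_k/n_k], k ∈ I, dense in ℂ, is a dense G_δ subset of (𝔽, d̃); the same holds with poles replaced by zeros. -/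
open Polynomial Filter Finset Metric Topology

noncomputable section

/-- Coefficient sequence extended to integer indices, with `a k = 0` for `k < 0`. -/
def acoefZ (a : ℕ → ℂ) (k : ℤ) : ℂ := if 0 ≤ k then a k.toNat else 0

/-- The Hankel determinant `C_{m,n} = det (a_{m-n+1+i+j})_{0 ≤ i,j ≤ n-1}`. -/
def hankelDet (a : ℕ → ℂ) (m n : ℕ) : ℂ :=
  Matrix.det (Matrix.of fun i j : Fin n => acoefZ a ((m : ℤ) - n + 1 + i + j))

/-- `IsPade a m n P Q` : the rational function `P/Q` is the Padé approximant of type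
`(m,n)` of the formal power series `∑ a_k z^k`. -/
def IsPade (a : ℕ → ℂ) (m n : ℕ) (P Q : Polynomial ℂ) : Prop :=
  P.natDegree ≤ m ∧ Q.natDegree ≤ n ∧ IsCoprime P Q ∧ Q.coeff 0 = 1 ∧
    ∀ j ≤ m + n, (∑ i ∈ Finset.range (j + 1), Q.coeff i * a (j - i)) = P.coeff j

/-- `𝒟_{m,n}` : the set of coefficient sequences whose Hankel determinant `C_{m,n}`
does not vanish. -/
def Dset (m n : ℕ) : Set (ℕ → ℂ) := {a | hankelDet a m n ≠ 0}

/-- `𝒩_{m,n}` : the subset of `𝒟_{m,n}` of series whose Padé denominator has exact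
degree `n`. -/
def Nset (m n : ℕ) : Set (ℕ → ℂ) :=
  {a | hankelDet a m n ≠ 0 ∧
    ∃ P Q : Polynomial ℂ, IsPade a m n P Q ∧ Q.degree = (n : WithBot ℕ)}

/-- The open unit disc in `ℂ`. -/
def unitD : Set ℂ := Metric.ball (0 : ℂ) 1

/-- The submodule of `ℂ → ℂ` of functions holomorphic on `Ω` (normalized to vanish
outside `Ω`, so that a function is determined by its restriction to `Ω`). -/
def holSubmodule (Ω : Set ℂ) : Submodule ℂ (ℂ → ℂ) where
  carrier := {f | DifferentiableOn ℂ f Ω ∧ ∀ z ∉ Ω, f z = 0}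
  add_mem' := fun hf hg => ⟨hf.1.add hg.1, fun z hz => by simp [hf.2 z hz, hg.2 z hz]⟩
  zero_mem' := ⟨differentiableOn_const 0, fun _ _ => rfl⟩
  smul_mem' := fun c f hf => ⟨hf.1.const_smul c, fun z hz => by simp [hf.2 z hz]⟩

/-- `H(Ω)`, the space of holomorphic functions on `Ω`. -/
abbrev Hol (Ω : Set ℂ) := ↥(holSubmodule Ω)

/-- The topology of uniform convergence on compact subsets of `Ω` on `H(Ω)`. -/
instance holTop (Ω : Set ℂ) : TopologicalSpace (Hol Ω) :=
  TopologicalSpace.induced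
    (fun f : Hol Ω => UniformOnFun.ofFun {K : Set Ω | IsCompact K} fun z : Ω => f.1 z)
    inferInstance

/-- The `k`-th Taylor coefficient at `0` of a function `f`. -/
def tc (f : ℂ → ℂ) (k : ℕ) : ℂ := iteratedDeriv k f 0 / k.factorial

/-- The set of poles of the Padé approximants `[a; m_k/n_k]` for `k ∈ I` : the roots of
the Padé denominators. -/
def padePoles (a : ℕ → ℂ) (m n : ℕ → ℕ) (I : Set ℕ) : Set ℂ :=
  {z | ∃ k ∈ I, ∃ P Q : Polynomial ℂ, IsPade a (m k) (n k) P Q ∧ Q.eval z = 0}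

/-- The set of zeros of the Padé approximants `[a; m_k/n_k]` for `k ∈ I` : the roots of
the Padé numerators. -/
def padeZeros (a : ℕ → ℂ) (m n : ℕ → ℕ) (I : Set ℕ) : Set ℂ :=
  {z | ∃ k ∈ I, ∃ P Q : Polynomial ℂ, IsPade a (m k) (n k) P Q ∧ P.eval z = 0}
/-- The space `𝔽` of formal power series, endowed with the metric `d̃` : the product
topology where each copy of `ℂ` carries the discrete topology. -/
def FDisc : Type := ℕ → ℂ

/-- The underlying coefficient sequence of an element of `(𝔽, d̃)`. -/
def FDisc.seq (a : FDisc) : ℕ → ℂ := a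

instance : TopologicalSpace FDisc :=
  @Pi.topologicalSpace ℕ (fun _ => ℂ) (fun _ => ⊥)

/-- A set defined by a condition on the first `N` coefficients is open in `(𝔽, d̃)`. -/
theorem FDisc.isOpen_of_local {S : Set FDisc} (N : ℕ)
    (h : ∀ a ∈ S, ∀ b : FDisc, (∀ i < N, b.seq i = a.seq i) → b ∈ S) : IsOpen S := by
  refine (@isOpen_pi_iff ℕ (fun _ => ℂ) (fun _ => ⊥) S).2 fun a ha => ?_
  refine ⟨Finset.range N, fun i => {a i}, fun i _ => ⟨trivial, rfl⟩, fun b hb => ?_⟩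
  exact h a ha b fun i hi => hb i (by simpa using hi)

/-- A set meeting every cylinder is dense in `(𝔽, d̃)`. -/
theorem FDisc.dense_of_approx {S : Set FDisc}
    (h : ∀ (a : FDisc) (L : ℕ), ∃ b ∈ S, ∀ i < L, b.seq i = a.seq i) : Dense S := by
  refine dense_iff_inter_open.2 fun U hU ⟨a, ha⟩ => ?_
  obtain ⟨I, u, hu, hsub⟩ := (@isOpen_pi_iff ℕ (fun _ => ℂ) (fun _ => ⊥) U).1 hU a ha
  obtain ⟨b, hb, hab⟩ := h a (I.sup id + 1)
  refine ⟨b, hsub fun i hi => ?_, hb⟩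
  have : b i = a i := hab i (Nat.lt_succ_of_le (Finset.le_sup (f := id) hi))
  rw [this]
  exact (hu i hi).2

/-- A countable power of a discrete space is a Baire space. -/
theorem baireSpace_nat_pi_discrete (E : Type*) [TopologicalSpace E] [DiscreteTopology E] :
    BaireSpace (ℕ → E) := inferInstance

instance FDisc.instBaireSpace : BaireSpace FDisc :=
  @baireSpace_nat_pi_discrete ℂ ⊥ (@DiscreteTopology.mk ℂ ⊥ rfl)

theorem hankelDet_congr {a b : ℕ → ℂ} {m n : ℕ} (h : ∀ i < m + n + 1, b i = a i) :
    hankelDet b m n = hankelDet a m n := by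
  unfold hankelDet
  congr 1
  ext i j
  simp only [Matrix.of_apply, acoefZ]
  split_ifs with hk
  · exact h _ (by omega)
  · rfl

theorem IsPade.congr {a b : ℕ → ℂ} {m n : ℕ} {P Q : ℂ[X]} (h : ∀ i < m + n + 1, b i = a i)
    (hP : IsPade a m n P Q) : IsPade b m n P Q := by
  obtain ⟨h1, h2, h3, h4, h5⟩ := hP
  refine ⟨h1, h2, h3, h4, fun j hj => ?_⟩
  rw [← h5 j hj]
  exact Finset.sum_congr rfl fun i _ => by rw [h _ (by omega)]

theorem isPade_of_mul_eq {P Q : ℂ[X]} {b : PowerSeries ℂ} {m n : ℕ} (hP : P.natDegree = m)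
    (hQ : Q.natDegree ≤ n) (hPQ : IsCoprime P Q) (hQ0 : Q.coeff 0 = 1)
    (hb : (Q : PowerSeries ℂ) * b = P) : IsPade (fun k => PowerSeries.coeff k b) m n P Q := by
  refine ⟨hP.le, hQ, hPQ, hQ0, fun j _ => ?_⟩
  rw [← Polynomial.coeff_coe P, ← hb, PowerSeries.coeff_mul,
    Finset.Nat.sum_antidiagonal_eq_sum_range_succ_mk]
  simp

/-- The Hankel determinant of a rational function `P / Q` in lowest terms does not vanish
at `(deg P, n)` when `deg Q ≤ n`. -/
theorem hankelDet_ne_zero_of_mul_eq {P Q : ℂ[X]} {b : PowerSeries ℂ} {m n : ℕ}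
    (hP0 : P ≠ 0) (hP : P.natDegree = m)
    (hQ : Q.natDegree ≤ n) (hPQ : IsCoprime P Q)
    (hb : (Q : PowerSeries ℂ) * b = P) : hankelDet (fun k => PowerSeries.coeff k b) m n ≠ 0 := by
  intro hdet
  obtain ⟨v, hv0, hv⟩ := Matrix.exists_mulVec_eq_zero_iff.2 hdet
  set V : ℂ[X] := ∑ j : Fin n, monomial (n - 1 - j) (v j) with hV
  have hVcoeff : ∀ j : Fin n, V.coeff (n - 1 - j) = v j := by
    intro j
    rw [hV, Polynomial.finsetSum_coeff, Finset.sum_eq_single j]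
    · simp
    · intro i _ hij
      rw [coeff_monomial, if_neg]
      intro h
      exact hij (Fin.ext (by omega))
    · simp
  have hVdeg : ∀ s, n ≤ s → V.coeff s = 0 := by
    intro s hs
    rw [hV, Polynomial.finsetSum_coeff]
    refine Finset.sum_eq_zero fun j _ => ?_
    rw [coeff_monomial, if_neg (by omega)]
  have hVb : ∀ i : Fin n, PowerSeries.coeff (m + i) ((V : PowerSeries ℂ) * b) = 0 := by
    intro i
    have hi := congrFun hv i
    rw [Matrix.mulVec, dotProduct, Pi.zero_apply] at hi
    have hcoe : (V : PowerSeries ℂ) = ∑ j : Fin n, PowerSeries.monomial (n - 1 - j) (v j) := by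
      rw [hV, ← Polynomial.coeToPowerSeries.ringHom_apply, map_sum]
      simp
    rw [← hi, hcoe, Finset.sum_mul, map_sum]
    refine Finset.sum_congr rfl fun j _ => ?_
    rw [PowerSeries.monomial_eq_C_mul_X_pow, mul_assoc, PowerSeries.coeff_C_mul,
      PowerSeries.coeff_X_pow_mul', mul_comm]
    simp only [Matrix.of_apply, acoefZ]
    congr 1
    split_ifs with h1 h2 h2
    · congr 2
      omega
    · omega
    · omega
    · rfl
  set W : ℂ[X] := PowerSeries.trunc m ((V : PowerSeries ℂ) * b) with hW
  have hdvd : (PowerSeries.X : PowerSeries ℂ) ^ (m + n) ∣ (V : PowerSeries ℂ) * b - W := by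
    rw [PowerSeries.X_pow_dvd_iff]
    intro s hs
    rw [map_sub, Polynomial.coeff_coe, hW, PowerSeries.coeff_trunc]
    split_ifs with h
    · simp
    · have := hVb ⟨s - m, by omega⟩
      rw [show m + (s - m) = s by omega] at this
      simp [this]
  have heq : V * P = Q * W := by
    have h2 : (PowerSeries.X : PowerSeries ℂ) ^ (m + n) ∣ ((V * P - Q * W : ℂ[X]) : PowerSeries ℂ) := by
      have h3 := hdvd.mul_left (Q : PowerSeries ℂ)
      convert h3 using 1
      rw [Polynomial.coe_sub, Polynomial.coe_mul, Polynomial.coe_mul, ← hb]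
      ring
    rw [PowerSeries.X_pow_dvd_iff] at h2
    rw [← sub_eq_zero]
    ext s
    rw [coeff_zero]
    by_cases hs : s < m + n
    · simpa only [Polynomial.coeff_coe, coeff_sub] using h2 s hs
    · have h4 : (V * P).coeff s = 0 := by
        rw [coeff_mul]
        refine Finset.sum_eq_zero fun x hx => ?_
        rw [HasAntidiagonal.mem_antidiagonal] at hx
        by_cases hx1 : n ≤ x.1
        · rw [hVdeg _ hx1, zero_mul]
        · rw [coeff_eq_zero_of_natDegree_lt (p := P) (by omega), mul_zero]
      have h5 : (Q * W).coeff s = 0 := by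
        rw [coeff_mul]
        refine Finset.sum_eq_zero fun x hx => ?_
        rw [HasAntidiagonal.mem_antidiagonal] at hx
        by_cases hx1 : x.2 < m
        · rw [coeff_eq_zero_of_natDegree_lt (p := Q) (by omega), zero_mul]
        · rw [hW, PowerSeries.coeff_trunc, if_neg hx1, mul_zero]
      rw [coeff_sub, h4, h5, sub_zero]
  obtain ⟨T, hT⟩ : Q ∣ V := hPQ.symm.dvd_of_dvd_mul_right ⟨W, heq⟩
  have hQ0 : Q ≠ 0 := by
    rintro rfl
    apply hP0
    rw [← Polynomial.coe_inj, ← hb]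
    simp
  have hWT : W = P * T := by
    apply mul_left_cancel₀ hQ0
    rw [← heq, hT]
    ring
  have hT0 : T = 0 := by
    by_contra hT0
    have h6 : W.coeff (P * T).natDegree = 0 := by
      rw [hW, PowerSeries.coeff_trunc, if_neg]
      rw [natDegree_mul hP0 hT0]
      omega
    rw [hWT] at h6
    exact mul_ne_zero hP0 hT0 (leadingCoeff_eq_zero.1 h6)
  apply hv0
  ext j
  rw [← hVcoeff j, hT, hT0]
  simp

/-- A rational function `P / Q` whose numerator agrees with `Q a` up to order `L` has the same
first `L` coefficients as `a`. -/
theorem coeff_eq_of_mul_eq {P Q : ℂ[X]} {a b : PowerSeries ℂ} {L : ℕ} (hQ0 : Q.coeff 0 = 1)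
    (hb : (Q : PowerSeries ℂ) * b = P)
    (hP : ∀ i < L, P.coeff i = PowerSeries.coeff i ((Q : PowerSeries ℂ) * a)) :
    ∀ i < L, PowerSeries.coeff i b = PowerSeries.coeff i a := by
  have hunit : IsUnit (Q : PowerSeries ℂ) := by
    rw [PowerSeries.isUnit_iff_constantCoeff, ← PowerSeries.coeff_zero_eq_constantCoeff_apply]
    simp [hQ0]
  have h : (PowerSeries.X : PowerSeries ℂ) ^ L ∣ (Q : PowerSeries ℂ) * (b - a) := by
    rw [PowerSeries.X_pow_dvd_iff]
    intro i hi
    rw [mul_sub, map_sub, hb, Polynomial.coeff_coe, hP i hi, sub_self]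
  rw [hunit.dvd_mul_left, PowerSeries.X_pow_dvd_iff] at h
  intro i hi
  simpa [sub_eq_zero] using h i hi

/-- Adding a monomial of degree `m` to a truncation of order `L ≤ m`. -/
theorem natDegree_trunc_add_C_mul_X_pow (f : PowerSeries ℂ) {L m : ℕ} (hL : L ≤ m) {c : ℂ}
    (hc : c ≠ 0) : (PowerSeries.trunc L f + C c * X ^ m).natDegree = m := by
  rw [natDegree_add_eq_right_of_degree_lt, natDegree_C_mul_X_pow m c hc]
  rw [degree_C_mul_X_pow m hc]
  exact (PowerSeries.degree_trunc_lt f L).trans_le (by exact_mod_cast hL)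

theorem exists_approx_pole (a : ℕ → ℂ) {L m n : ℕ} (hL : L ≤ m) (hm : 0 < m) (hn : 0 < n) {z : ℂ}
    (hz : z ≠ 0) : ∃ b : ℕ → ℂ, (∀ i < L, b i = a i) ∧ b ∈ Dset m n ∧
      ∃ P Q : ℂ[X], IsPade b m n P Q ∧ Q.eval z = 0 := by
  set Q : ℂ[X] := C (-z⁻¹) * (X - C z) with hQ
  have hQ0 : Q.coeff 0 = 1 := by
    simp [hQ, hz]
  have hQdeg : Q.natDegree ≤ n := by
    rw [hQ, natDegree_C_mul (by simpa using hz), natDegree_X_sub_C]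
    exact hn
  set R : ℂ[X] := PowerSeries.trunc L ((Q : PowerSeries ℂ) * PowerSeries.mk a) with hR
  obtain ⟨c, hc, hcR⟩ : ∃ c : ℂ, c ≠ 0 ∧ R.eval z + c * z ^ m ≠ 0 := by
    by_cases h : R.eval z + 1 * z ^ m = 0
    · refine ⟨2, two_ne_zero, fun h' => pow_ne_zero m hz ?_⟩
      linear_combination h' - h
    · exact ⟨1, one_ne_zero, h⟩
  set P : ℂ[X] := R + C c * X ^ m with hP
  have hPdeg : P.natDegree = m := natDegree_trunc_add_C_mul_X_pow _ hL hc
  have hP0 : P ≠ 0 := by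
    intro h
    rw [h, natDegree_zero] at hPdeg
    omega
  have hPQ : IsCoprime P Q := by
    refine (isCoprime_mul_unit_left_right (isUnit_C.2 (by simpa using hz)) _ _).2 ?_
    refine ((irreducible_X_sub_C z).coprime_iff_not_dvd.2 ?_).symm
    rw [dvd_iff_isRoot]
    simpa [hP, IsRoot] using hcR
  set b : PowerSeries ℂ := (Q : PowerSeries ℂ)⁻¹ * P with hbdef
  have hb : (Q : PowerSeries ℂ) * b = P := by
    rw [hbdef, ← mul_assoc, PowerSeries.mul_inv_cancel, one_mul]
    rw [← PowerSeries.coeff_zero_eq_constantCoeff_apply]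
    simp [hQ0]
  refine ⟨fun k => PowerSeries.coeff k b, ?_, hankelDet_ne_zero_of_mul_eq hP0 hPdeg hQdeg hPQ hb,
    P, Q, isPade_of_mul_eq hPdeg hQdeg hPQ hQ0 hb, by simp [hQ]⟩
  have := coeff_eq_of_mul_eq (a := PowerSeries.mk a) (L := L) hQ0 hb fun i hi => by
    rw [hP, coeff_add, hR, PowerSeries.coeff_trunc, if_pos hi, coeff_C_mul_X_pow,
      if_neg (by omega), add_zero]
  simpa using this

theorem exists_approx_zero (a : ℕ → ℂ) {L m n : ℕ} (hL : L + 1 ≤ m) {z : ℂ}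
    (hz : z ≠ 0) : ∃ b : ℕ → ℂ, (∀ i < L, b i = a i) ∧ b ∈ Dset m n ∧
      ∃ P Q : ℂ[X], IsPade b m n P Q ∧ P.eval z = 0 := by
  obtain ⟨a', ha', hR⟩ : ∃ a' : ℕ → ℂ, (∀ i < L, a' i = a i) ∧
      (PowerSeries.trunc (L + 1) (PowerSeries.mk a')).eval z ≠ 0 := by
    have key : ∀ d : ℂ, (PowerSeries.trunc (L + 1)
        (PowerSeries.mk (Function.update a L d))).eval z =
          (PowerSeries.trunc L (PowerSeries.mk a)).eval z + d * z ^ L := by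
      intro d
      rw [PowerSeries.trunc_succ, eval_add, eval_monomial, PowerSeries.coeff_mk,
        Function.update_self]
      congr 2
      ext i
      rw [PowerSeries.coeff_trunc, PowerSeries.coeff_trunc]
      split_ifs with hi
      · simp [hi.ne]
      · rfl
    have hupd : ∀ d : ℂ, ∀ i < L, Function.update a L d i = a i := fun d i hi => by
      simp [hi.ne]
    by_cases h : (PowerSeries.trunc L (PowerSeries.mk a)).eval z = 0
    · exact ⟨_, hupd 1, by rw [key, h]; simpa using fun h' => absurd h' hz⟩
    · exact ⟨_, hupd 0, by rw [key]; simpa using h⟩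
  set R : ℂ[X] := PowerSeries.trunc (L + 1) (PowerSeries.mk a') with hRdef
  have hc : -R.eval z / z ^ m ≠ 0 := div_ne_zero (neg_ne_zero.2 hR) (pow_ne_zero m hz)
  set P : ℂ[X] := R + C (-R.eval z / z ^ m) * X ^ m with hP
  have hPdeg : P.natDegree = m := natDegree_trunc_add_C_mul_X_pow _ hL hc
  have hP0 : P ≠ 0 := by
    intro h
    rw [h, natDegree_zero] at hPdeg
    omega
  have hb : ((1 : ℂ[X]) : PowerSeries ℂ) * (P : PowerSeries ℂ) = P := by simp
  refine ⟨fun k => PowerSeries.coeff k (P : PowerSeries ℂ), fun i hi => ?_,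
    hankelDet_ne_zero_of_mul_eq hP0 hPdeg (by simp) isCoprime_one_right hb,
    P, 1, isPade_of_mul_eq hPdeg (by simp) isCoprime_one_right (by simp) hb, ?_⟩
  · simp only [Polynomial.coeff_coe]
    rw [hP, coeff_add, hRdef, PowerSeries.coeff_trunc, if_pos (by omega), coeff_C_mul_X_pow,
      if_neg (by omega), add_zero, PowerSeries.coeff_mk, ha' i hi]
  · have := pow_ne_zero m hz
    simp only [hP, eval_add, eval_mul, eval_C, eval_pow, eval_X]
    field_simp
    ring

theorem exists_ge_and_lt_of_unbounded {m : ℕ → ℕ} (hub : ∀ N : ℕ, ∃ k, N < m k) (N L : ℕ) :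
    ∃ k ≥ N, L < m k := by
  obtain ⟨k, hk⟩ := hub (L + ∑ i ∈ Finset.range N, m i)
  refine ⟨k, ?_, by omega⟩
  by_contra h
  have := Finset.single_le_sum (f := m) (fun i _ => Nat.zero_le _)
    (Finset.mem_range.2 (not_le.1 h))
  omega

/-- Genericity of universality for a family of sets `root m n a ⊆ ℂ` depending only on finitely
many coefficients of `a`, and meeting any prescribed point after changing `a` only at
coefficients of large index. -/
theorem isGδ_dense_of_local_of_approx (m n : ℕ → ℕ) (hn : ∀ k, 0 < n k)
    (hub : ∀ N : ℕ, ∃ k, N < m k) (root : ℕ → ℕ → (ℕ → ℂ) → Set ℂ)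
    (hlocal : ∀ (p q : ℕ) (a b : ℕ → ℂ), (∀ i < p + q + 1, b i = a i) →
      root p q a ⊆ root p q b)
    (happrox : ∀ (a : ℕ → ℂ) (L p q : ℕ), L < p → 0 < q → ∀ z : ℂ, z ≠ 0 →
      ∃ b : ℕ → ℂ, (∀ i < L, b i = a i) ∧ b ∈ Dset p q ∧ z ∈ root p q b) :
    IsGδ {a : FDisc | ∃ I : Set ℕ, I.Infinite ∧ (∀ k ∈ I, a.seq ∈ Dset (m k) (n k)) ∧
        Dense {z | ∃ k ∈ I, z ∈ root (m k) (n k) a.seq}} ∧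
      Dense {a : FDisc | ∃ I : Set ℕ, I.Infinite ∧ (∀ k ∈ I, a.seq ∈ Dset (m k) (n k)) ∧
        Dense {z | ∃ k ∈ I, z ∈ root (m k) (n k) a.seq}} := by
  set B := TopologicalSpace.countableBasis ℂ
  have hB : B.Countable := TopologicalSpace.countable_countableBasis ℂ
  have hBasis := TopologicalSpace.isBasis_countableBasis ℂ
  set G : ℕ → Set FDisc := fun N => ⋃ k ≥ N, {a | a.seq ∈ Dset (m k) (n k)} with hG
  set H : Set ℂ → Set FDisc := fun o =>
    ⋃ k, {a | a.seq ∈ Dset (m k) (n k) ∧ (o ∩ root (m k) (n k) a.seq).Nonempty} with hH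
  have hset : {a : FDisc | ∃ I : Set ℕ, I.Infinite ∧ (∀ k ∈ I, a.seq ∈ Dset (m k) (n k)) ∧
      Dense {z | ∃ k ∈ I, z ∈ root (m k) (n k) a.seq}} = (⋂ N, G N) ∩ ⋂ o ∈ B, H o := by
    ext a
    simp only [Set.mem_ofPred_eq, Set.mem_inter_iff, Set.mem_iInter, hG, hH, Set.mem_iUnion]
    constructor
    · rintro ⟨I, hI, hD, hdense⟩
      refine ⟨fun N => ?_, fun o ho => ?_⟩
      · obtain ⟨k, hk, hNk⟩ := hI.exists_gt N
        exact ⟨k, hNk.le, hD k hk⟩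
      · obtain ⟨z, hzo, k, hk, hz⟩ :=
          hBasis.dense_iff.1 hdense o ho (TopologicalSpace.nonempty_of_mem_countableBasis ho)
        exact ⟨k, hD k hk, z, hzo, hz⟩
    · rintro ⟨h1, h2⟩
      refine ⟨{k | a.seq ∈ Dset (m k) (n k)}, ?_, fun k hk => hk, ?_⟩
      · refine Set.infinite_of_forall_exists_gt fun N => ?_
        obtain ⟨k, hk, hD⟩ := h1 (N + 1)
        exact ⟨k, hD, hk⟩
      · refine hBasis.dense_iff.2 fun o ho _ => ?_
        obtain ⟨k, hD, z, hzo, hz⟩ := h2 o ho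
        exact ⟨z, hzo, k, hD, hz⟩
  have hGo : ∀ N, IsOpen (G N) := fun N => isOpen_iUnion fun k => isOpen_iUnion fun _ =>
    FDisc.isOpen_of_local (m k + n k + 1) fun a ha b hab => by
      simp only [Set.mem_ofPred_eq, Dset] at ha ⊢
      rwa [hankelDet_congr hab]
  have hHo : ∀ o ∈ B, IsOpen (H o) := fun o _ => isOpen_iUnion fun k =>
    FDisc.isOpen_of_local (m k + n k + 1) fun a ha b hab => by
      simp only [Set.mem_ofPred_eq, Dset] at ha ⊢
      rw [hankelDet_congr hab]
      exact ⟨ha.1, ha.2.mono (Set.inter_subset_inter_right _ (hlocal _ _ _ _ hab))⟩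
  have hGd : ∀ N, Dense (G N) := fun N => FDisc.dense_of_approx fun a L => by
    obtain ⟨k, hk, hLk⟩ := exists_ge_and_lt_of_unbounded hub N L
    obtain ⟨b, hb, hbD, -⟩ := happrox a.seq L (m k) (n k) hLk (hn k) 1 one_ne_zero
    exact ⟨b, Set.mem_biUnion (x := k) hk hbD, hb⟩
  have hHd : ∀ o ∈ B, Dense (H o) := fun o ho => FDisc.dense_of_approx fun a L => by
    obtain ⟨k, hLk⟩ := hub L
    obtain ⟨z, hzo, hz⟩ := (dense_compl_singleton (0 : ℂ)).inter_open_nonempty o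
      (TopologicalSpace.isOpen_of_mem_countableBasis ho)
      (TopologicalSpace.nonempty_of_mem_countableBasis ho)
    obtain ⟨b, hb, hbD, hbz⟩ := happrox a.seq L (m k) (n k) hLk (hn k) z hz
    exact ⟨b, Set.mem_iUnion.2 ⟨k, hbD, z, hzo, hbz⟩, hb⟩
  rw [hset]
  have hG1 : IsGδ (⋂ N, G N) := .iInter_of_isOpen hGo
  have hH1 : IsGδ (⋂ o ∈ B, H o) := .biInter_of_isOpen hB hHo
  exact ⟨hG1.inter hH1, (dense_iInter_of_isOpen hGo hGd).inter_of_Gδ hG1 hH1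
    (dense_biInter_of_isOpen hHo hB hHd)⟩

/-- Theorem 3.4 : in `(𝔽, d̃)`, for a sequence `(m_k, n_k)_k` of pairs of positive
integers with `(m_k)_k` unbounded, the set of series `f` admitting an infinite set
`I ⊆ ℕ` with `f ∈ 𝒟_{m_k,n_k}` for all `k ∈ I` and with the poles (resp. zeros) of the
`[f; m_k/n_k]`, `k ∈ I`, dense in `ℂ`, is a dense `G_δ` subset of `(𝔽, d̃)`. -/
theorem stmt_6 (m n : ℕ → ℕ) (hm : ∀ k, 0 < m k) (hn : ∀ k, 0 < n k)
    (hub : ∀ N : ℕ, ∃ k, N < m k) :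
    (IsGδ {a : FDisc | ∃ I : Set ℕ, I.Infinite ∧ (∀ k ∈ I, a.seq ∈ Dset (m k) (n k)) ∧
        Dense (padePoles a.seq m n I)} ∧
      Dense {a : FDisc | ∃ I : Set ℕ, I.Infinite ∧ (∀ k ∈ I, a.seq ∈ Dset (m k) (n k)) ∧
        Dense (padePoles a.seq m n I)}) ∧
    (IsGδ {a : FDisc | ∃ I : Set ℕ, I.Infinite ∧ (∀ k ∈ I, a.seq ∈ Dset (m k) (n k)) ∧
        Dense (padeZeros a.seq m n I)} ∧
      Dense {a : FDisc | ∃ I : Set ℕ, I.Infinite ∧ (∀ k ∈ I, a.seq ∈ Dset (m k) (n k)) ∧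
        Dense (padeZeros a.seq m n I)}) := by
  constructor
  · refine isGδ_dense_of_local_of_approx m n hn hub
      (fun p q a => {z | ∃ P Q : ℂ[X], IsPade a p q P Q ∧ Q.eval z = 0}) ?_ ?_
    · rintro p q a b hab z ⟨P, Q, h, hz⟩
      exact ⟨P, Q, h.congr hab, hz⟩
    · exact fun a L p q hL hq z hz => exists_approx_pole a hL.le (by omega) hq hz
  · refine isGδ_dense_of_local_of_approx m n hn hub
      (fun p q a => {z | ∃ P Q : ℂ[X], IsPade a p q P Q ∧ P.eval z = 0}) ?_ ?_
    · rintro p q a b hab z ⟨P, Q, h, hz⟩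
      exact ⟨P, Q, h.congr hab, hz⟩
    · exact fun a L p q hL _ z hz => exists_approx_zero a hL hz

end
end

section
/- Let Ω be a simply connected domain in ℂ containing 0, and let (m_k,n_k)_{k≥0} be a sequence of pairs of positive integers such that (m_k)_{k≥0} is unbounded. Then the set of functions f ∈ H(Ω) such that there exists an infinite set I ⊂ ℕ with f ∈ 𝒩_{m_k,n_k} for all k ∈ I and such that the Padé approximants [f; m_k/n_k] converge to f uniformly on every compact subset of Ω as k → ∞ along I, is a dense G_δ subset of H(Ω). -/
open Polynomial Filter Finset Metric Topology

noncomputable section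

/-- The Wirtinger derivative `∂F/∂z̄`. -/
def wirtingerBar (F : ℂ → ℂ) (z : ℂ) : ℂ :=
  (fderiv ℝ F z 1 + Complex.I * fderiv ℝ F z Complex.I) / 2

lemma wirtingerBar_eq_zero_of_differentiableAt {F : ℂ → ℂ} {z : ℂ} (h : DifferentiableAt ℂ F z) :
    wirtingerBar F z = 0 := by
  have h1 : fderiv ℝ F z = (fderiv ℂ F z).restrictScalars ℝ :=
    (h.hasFDerivAt.restrictScalars ℝ).fderiv
  have h2 : fderiv ℂ F z Complex.I = Complex.I * fderiv ℂ F z 1 := by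
    simp
  simp only [wirtingerBar, h1, ContinuousLinearMap.coe_restrictScalars', h2]
  linear_combination (fderiv ℂ F z 1 / 2) * Complex.I_mul_I

lemma continuous_wirtingerBar {F : ℂ → ℂ} (hF : ContDiff ℝ 1 F) :
    Continuous (wirtingerBar F) := by
  have h := hF.continuous_fderiv one_ne_zero
  unfold wirtingerBar
  fun_prop

open MeasureTheory Real in
lemma integrableOn_polar_of_continuous {g : ℝ × ℝ → ℂ} (hg : Continuous g) (R : ℝ)
    (hR : ∀ p : ℝ × ℝ, R < p.1 → g p = 0) :
    IntegrableOn g (Set.Ioi (0 : ℝ) ×ˢ Set.Ioo (-π) π) := by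
  have h : IntegrableOn g (Set.Icc 0 R ×ˢ Set.Icc (-π) π) :=
    hg.continuousOn.integrableOn_compact (isCompact_Icc.prod isCompact_Icc)
  refine h.of_forall_sdiff_eq_zero (measurableSet_Ioi.prod measurableSet_Ioo) ?_
  rintro ⟨r, t⟩ ⟨⟨h1, h2⟩, h3⟩
  refine hR _ ?_
  by_contra! h4
  exact h3 ⟨⟨le_of_lt h1, h4⟩, ⟨h2.1.le, h2.2.le⟩⟩

open MeasureTheory Real in
lemma integral_wirtingerBar_mul_inv {F : ℂ → ℂ} (hF : ContDiff ℝ 1 F) (hc : HasCompactSupport F) :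
    ∫ w, wirtingerBar F w * w⁻¹ = -π * F 0 := by
  let u : ℝ → ℂ := fun t => Real.cos t + Real.sin t * Complex.I
  have hu : ∀ t, HasDerivAt u (Complex.I * u t) t := by
    intro t
    have h1 := (Real.hasDerivAt_cos t).ofReal_comp
    have h2 := ((Real.hasDerivAt_sin t).ofReal_comp).mul_const Complex.I
    convert! h1.add h2 using 1
    simp only [u]
    push_cast
    linear_combination (Complex.sin t : ℂ) * Complex.I_mul_I
  have huc : Continuous u := continuous_iff_continuousAt.2 fun t => (hu t).continuousAt
  have hnu : ∀ t, ‖u t‖ = 1 := by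
    intro t
    simp only [u]
    rw [Complex.ofReal_cos, Complex.ofReal_sin, ← Complex.exp_mul_I]
    exact Complex.norm_exp_ofReal_mul_I t
  have hfd : Continuous (fderiv ℝ F) := hF.continuous_fderiv one_ne_zero
  obtain ⟨R, hR⟩ : ∃ R : ℝ, ∀ w : ℂ, R < ‖w‖ → fderiv ℝ F w = 0 := by
    obtain ⟨R, hR⟩ := (hc.fderiv ℝ).isCompact.isBounded.subset_closedBall 0
    refine ⟨R, fun w hw => ?_⟩
    by_contra h
    have := hR (subset_tsupport _ h)
    simp at this
    linarith
  let A : ℝ × ℝ → ℂ := fun p => fderiv ℝ F (p.1 * u p.2) (u p.2)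
  let B : ℝ × ℝ → ℂ := fun p => fderiv ℝ F (p.1 * u p.2) (Complex.I * u p.2)
  have hAc : Continuous A := by fun_prop
  have hBc : Continuous B := by fun_prop
  have hz : ∀ p : ℝ × ℝ, R < p.1 → fderiv ℝ F (p.1 * u p.2) = 0 := by
    intro p hp
    refine hR _ ?_
    rw [norm_mul, hnu, mul_one, Complex.norm_real]
    exact hp.trans_le (le_abs_self _)
  have hAi := integrableOn_polar_of_continuous hAc R fun p hp => by simp [A, hz p hp]
  have hBi := integrableOn_polar_of_continuous hBc R fun p hp => by simp [B, hz p hp]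
  have hFd : ∀ w, HasFDerivAt F (fderiv ℝ F w) w := fun w =>
    (hF.differentiable one_ne_zero w).hasFDerivAt
  have hA : ∫ p in Set.Ioi (0 : ℝ) ×ˢ Set.Ioo (-π) π, A p = -(2 * π) * F 0 := by
    rw [Measure.volume_eq_prod, ← setIntegral_prod_swap, setIntegral_prod]
    · have h1 : ∀ t, ∫ r in Set.Ioi (0 : ℝ), A (r, t) = - F 0 := by
        intro t
        have hut : u t ≠ 0 := fun h => by simpa [h] using hnu t
        have hd : ∀ r : ℝ, HasDerivAt (fun r : ℝ => F (r * u t)) (A (r, t)) r := by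
          intro r
          have h2 : HasDerivAt (fun r : ℝ => (r : ℂ) * u t) (u t) r := by
            simpa using (Complex.ofRealCLM.hasDerivAt (x := r)).mul_const (u t)
          exact (hFd _).comp_hasDerivAt r h2
        have hcs : HasCompactSupport fun r : ℝ => F (r * u t) := by
          refine hc.comp_isClosedEmbedding
            (Isometry.isClosedEmbedding (Isometry.of_dist_eq fun x y => ?_))
          rw [Complex.dist_eq, ← sub_mul, norm_mul, hnu, mul_one, ← Complex.ofReal_sub,
            Complex.norm_real, Real.dist_eq, Real.norm_eq_abs]
        have hcd : ContDiff ℝ 1 fun r : ℝ => F (r * u t) :=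
          hF.comp (Complex.ofRealCLM.contDiff.mul contDiff_const)
        have h3 := hcs.integral_Ioi_deriv_eq hcd 0
        simpa [(hd _).deriv] using h3
      simp only [Prod.swap_prod_mk, h1]
      rw [setIntegral_const]
      simp only [Real.volume_real_Ioo, Complex.real_smul]
      rw [max_eq_left (by linarith [pi_pos])]
      push_cast
      ring
    · exact hAi.swap
  have hB : ∫ p in Set.Ioi (0 : ℝ) ×ˢ Set.Ioo (-π) π, B p = 0 := by
    rw [Measure.volume_eq_prod, setIntegral_prod _ hBi]
    refine setIntegral_eq_zero_of_forall_eq_zero fun r hr => ?_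
    have hr0 : (r : ℂ) ≠ 0 := Complex.ofReal_ne_zero.2 (ne_of_gt hr)
    have hd : ∀ t, HasDerivAt (fun t : ℝ => F (r * u t))
        (fderiv ℝ F (r * u t) (r * (Complex.I * u t))) t := fun t => (hFd _).comp_hasDerivAt t ((hu t).const_mul _)
    rw [← integral_Ioc_eq_integral_Ioo, ← intervalIntegral.integral_of_le (by linarith [pi_pos])]
    have h1 := intervalIntegral.integral_eq_sub_of_hasDerivAt (a := -π) (b := π) (fun t _ => hd t)
      (Continuous.intervalIntegrable (by fun_prop) _ _)
    have h2 : ∀ t, B (r, t) = (r : ℂ)⁻¹ * fderiv ℝ F (r * u t) (r * (Complex.I * u t)) := by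
      intro t
      have := (fderiv ℝ F (r * u t)).map_smul r (Complex.I * u t)
      simp only [Complex.real_smul] at this
      rw [this, inv_mul_cancel_left₀ hr0]
    simp only [h2]
    rw [intervalIntegral.integral_const_mul, h1]
    simp [u]
  rw [← Complex.integral_comp_polarCoord_symm, polarCoord_target]
  have key : ∀ p ∈ Set.Ioi (0 : ℝ) ×ˢ Set.Ioo (-π) π,
      p.1 • (wirtingerBar F (Complex.polarCoord.symm p) * (Complex.polarCoord.symm p)⁻¹)
        = (1 / 2) * A p + (Complex.I / 2) * B p := by
    rintro ⟨r, t⟩ ⟨hr, -⟩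
    have hr0 : (r : ℂ) ≠ 0 := by simpa using (ne_of_gt hr)
    have hu0 : u t ≠ 0 := fun h => by simpa [h] using hnu t
    have e1 : Complex.polarCoord.symm (r, t) = r * u t := Complex.polarCoord_symm_apply _
    set L := fderiv ℝ F (r * u t) with hL
    have hlin : ∀ x y : ℝ, L (x + y * Complex.I) = x * L 1 + y * L Complex.I := by
      intro x y
      have h1 := L.map_smul x 1
      have h2 := L.map_smul y Complex.I
      simp only [Complex.real_smul, mul_one] at h1 h2
      rw [map_add, h1, h2]
    have e2 : A (r, t) = Real.cos t * L 1 + Real.sin t * L Complex.I := hlin _ _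
    have e3 : B (r, t) = (-Real.sin t : ℝ) * L 1 + Real.cos t * L Complex.I := by
      rw [← hlin]
      change L (Complex.I * u t) = _
      congr 1
      simp only [u]
      push_cast
      linear_combination (Complex.sin t : ℂ) * Complex.I_mul_I
    have e4 : (u t)⁻¹ = Real.cos t - Real.sin t * Complex.I := by
      apply inv_eq_of_mul_eq_one_right
      have := Complex.sin_sq_add_cos_sq t
      simp only [u]
      push_cast
      linear_combination this - (Complex.sin t : ℂ) ^ 2 * Complex.I_mul_I
    rw [e1, e2, e3, mul_inv, e4]
    simp only [wirtingerBar, ← hL, Complex.real_smul]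
    field_simp
    push_cast
    linear_combination (-(Complex.sin t : ℂ) * L Complex.I) * Complex.I_mul_I
  rw [setIntegral_congr_fun (measurableSet_Ioi.prod measurableSet_Ioo) key, integral_add
    (hAi.const_mul _) (hBi.const_mul _), integral_const_mul, integral_const_mul, hA, hB]
  ring

open MeasureTheory Real in
/-- The Cauchy–Pompeiu formula for compactly supported functions. -/
lemma integral_wirtingerBar_mul_inv_sub {F : ℂ → ℂ} (hF : ContDiff ℝ 1 F)
    (hc : HasCompactSupport F) (z : ℂ) :
    ∫ w, wirtingerBar F w * (w - z)⁻¹ = -π * F z := by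
  have h1 : ContDiff ℝ 1 fun w => F (w + z) := hF.comp (contDiff_id.add contDiff_const)
  have h2 : HasCompactSupport fun w => F (w + z) :=
    hc.comp_isClosedEmbedding (Homeomorph.addRight z).isClosedEmbedding
  have h3 : ∀ w, wirtingerBar (fun w => F (w + z)) w = wirtingerBar F (w + z) := by
    intro w
    simp [wirtingerBar, fderiv_comp_add_right]
  have h4 := integral_wirtingerBar_mul_inv h1 h2
  rw [← integral_add_right_eq_self _ z]
  simpa [h3] using h4

/-- A smooth compactly supported function on `ℂ` extending a holomorphic function from a
neighbourhood of a compact set. -/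
lemma exists_contDiff_hasCompactSupport_eventuallyEq {Ω K : Set ℂ} (hΩ : IsOpen Ω)
    (hK : IsCompact K) (hKΩ : K ⊆ Ω) {f : ℂ → ℂ} (hf : DifferentiableOn ℂ f Ω) :
    ∃ F : ℂ → ℂ, ContDiff ℝ 1 F ∧ HasCompactSupport F ∧ (∀ᶠ z in 𝓝ˢ K, F z = f z) ∧
      tsupport F ⊆ Ω := by
  obtain ⟨K', hK', hKK', hK'Ω⟩ := exists_compact_between hK hΩ hKΩ
  obtain ⟨φ, hφ1, hφ0, -⟩ := exists_contMDiffMap_one_nhds_of_subset_interior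
    (n := 1) (modelWithCornersSelf ℝ ℂ) hK.isClosed hKK'
  have hφ : ContDiff ℝ 1 φ := φ.contMDiff.contDiff
  have hs : tsupport (fun z => (φ z : ℂ) * f z) ⊆ K' := by
    refine closure_minimal (fun z hz => ?_) hK'.isClosed
    by_contra h
    simp [hφ0 z h] at hz
  refine ⟨fun z => φ z * f z, ?_, HasCompactSupport.of_support_subset_isCompact hK'
    ((subset_tsupport _).trans hs), ?_, hs.trans hK'Ω⟩
  · rw [contDiff_iff_contDiffAt]
    intro z
    by_cases hz : z ∈ K'
    · have h1 : ContDiffAt ℂ 1 f z :=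
        (hf.analyticAt (hΩ.mem_nhds (hK'Ω hz))).contDiffAt
      exact (Complex.ofRealCLM.contDiff.comp hφ).contDiffAt.mul (h1.restrict_scalars ℝ)
    · have h1 : (fun z => (φ z : ℂ) * f z) =ᶠ[𝓝 z] fun _ => 0 := by
        filter_upwards [hK'.isClosed.isOpen_compl.mem_nhds hz] with w hw
        simp [hφ0 w hw]
      exact contDiffAt_const.congr_of_eventuallyEq h1
  · filter_upwards [hφ1] with z hz
    simp [hz]

open MeasureTheory Real in
/-- Runge's theorem for polynomials, on a compact set all of whose complementary components are
unbounded. -/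
theorem exists_polynomial_near_of_unbounded_components {Ω K : Set ℂ} (hΩ : IsOpen Ω)
    (hK : IsCompact K) (hKΩ : K ⊆ Ω)
    (hub : ∀ z ∉ K, ¬ Bornology.IsBounded (connectedComponentIn Kᶜ z))
    {f : ℂ → ℂ} (hf : DifferentiableOn ℂ f Ω) {ε : ℝ} (hε : 0 < ε) :
    ∃ p : ℂ[X], ∀ z ∈ K, ‖p.eval z - f z‖ < ε := by
  obtain ⟨F, hF, hFc, hFf, -⟩ := exists_contDiff_hasCompactSupport_eventuallyEq hΩ hK hKΩ hf
  have : CompactSpace K := isCompact_iff_compactSpace.1 hK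
  let a : C(K, ℂ) := ⟨fun z => z, continuous_subtype_val⟩
  let S : Subalgebra ℂ C(K, ℂ) := (Algebra.adjoin ℂ {a}).topologicalClosure
  have hScl : IsClosed (S : Set C(K, ℂ)) := Subalgebra.isClosed_topologicalClosure _
  have hSc : CompleteSpace S := hScl.completeSpace_coe
  let x : S := ⟨a, Subalgebra.le_topologicalClosure _ (Algebra.self_mem_adjoin_singleton ℂ a)⟩
  have hspec : spectrum ℂ a = K := by
    rw [ContinuousMap.spectrum_eq_range]
    exact Subtype.range_coe
  have hres : ∀ w ∉ K, w ∈ resolventSet ℂ x := by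
    intro w hw
    by_contra h
    have := Subalgebra.spectrum_isBounded_connectedComponentIn (hS := hScl) S x (z := w) h
    change Bornology.IsBounded (connectedComponentIn (spectrum ℂ a)ᶜ w) at this
    rw [hspec] at this
    exact hub w hw this
  have hval : ∀ w ∉ K, ∀ z : K, ((resolvent x w : S) : C(K, ℂ)) z = (w - z)⁻¹ := by
    intro w hw z
    have h1 : (algebraMap ℂ S w - x) * resolvent x w = 1 := by
      exact Ring.mul_inverse_cancel _ (hres w hw)
    have h2 := congrArg (fun y : S => (y : C(K, ℂ)) z) h1
    have h3 : (w - z) * ((resolvent x w : S) : C(K, ℂ)) z = 1 := h2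
    exact eq_inv_of_mul_eq_one_right h3
  let G : ℂ → S := fun w => wirtingerBar F w • resolvent x w
  have hW0 : ∀ w ∈ K, ∀ᶠ v in 𝓝 w, wirtingerBar F v = 0 := by
    intro w hw
    have h1 : ∀ᶠ v in 𝓝 w, F v = f v := hFf.filter_mono (nhds_le_nhdsSet hw)
    filter_upwards [h1.eventually_nhds, hΩ.mem_nhds (hKΩ hw)] with v hv hvΩ
    have h2 : F =ᶠ[𝓝 v] f := hv
    exact wirtingerBar_eq_zero_of_differentiableAt
      (((hf v hvΩ).differentiableAt (hΩ.mem_nhds hvΩ)).congr_of_eventuallyEq h2)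
  have hGc : Continuous G := by
    rw [continuous_iff_continuousAt]
    intro w
    by_cases hw : w ∈ K
    · have h1 : G =ᶠ[𝓝 w] fun _ => 0 := by
        filter_upwards [hW0 w hw] with v hv
        simp [G, hv]
      exact continuousAt_const.congr h1.symm
    · exact (continuous_wirtingerBar hF).continuousAt.smul
        (spectrum.hasDerivAt_resolvent_const_left (hres w hw)).continuousAt
  have hGs : HasCompactSupport G := by
    have h1 : HasCompactSupport (wirtingerBar F) := by
      refine (hFc.fderiv ℝ).mono fun w hw => ?_
      contrapose! hw
      simp only [Function.mem_support, not_not] at hw ⊢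
      simp [wirtingerBar, hw]
    exact h1.smul_right
  have hGi : Integrable G := hGc.integrable_of_hasCompactSupport hGs
  have hmem : (∫ w, G w : S).1 ∈ closure (Algebra.adjoin ℂ {a} : Set C(K, ℂ)) :=
    (∫ w, G w : S).2
  have hevalK : ∀ z : K, (∫ w, G w : S).1 z = -π * f z := by
    intro z
    let L : S →L[ℂ] ℂ := (ContinuousMap.evalCLM ℂ z).comp S.toSubmodule.subtypeL
    have h1 : L (∫ w, G w) = ∫ w, L (G w) := (L.integral_comp_comm hGi).symm
    have h2 : ∀ w, L (G w) = wirtingerBar F w * (w - z)⁻¹ := by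
      intro w
      by_cases hw : w ∈ K
      · have := (hW0 w hw).self_of_nhds
        simp [G, this]
      · rw [← hval w hw z]
        rfl
    simp only [h2] at h1
    rw [integral_wirtingerBar_mul_inv_sub hF hFc] at h1
    rw [← (hFf.filter_mono (nhds_le_nhdsSet z.2)).self_of_nhds]
    exact h1
  obtain ⟨b, hb, hbd⟩ := Metric.mem_closure_iff.1 hmem (π * ε) (by positivity)
  rw [SetLike.mem_coe, Algebra.adjoin_singleton_eq_range_aeval] at hb
  obtain ⟨p, rfl⟩ := hb
  refine ⟨C (-(π : ℂ)⁻¹) * p, fun z hz => ?_⟩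
  have h1 := ((ContinuousMap.dist_lt_iff (by positivity)).1 hbd) ⟨z, hz⟩
  rw [hevalK] at h1
  have h2 : (aeval a p : C(K, ℂ)) ⟨z, hz⟩ = p.eval z := by
    have := Polynomial.aeval_algHom_apply (ContinuousMap.evalAlgHom ℂ ℂ (⟨z, hz⟩ : K)) a p
    exact this.symm.trans (by simp [Polynomial.aeval_def, Polynomial.eval₂_eq_eval_map, a])
  have h2' : (p.aeval a : C(K, ℂ)) ⟨z, hz⟩ = p.eval z := h2
  change dist _ ((p.aeval a : C(K, ℂ)) ⟨z, hz⟩) < _ at h1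
  rw [h2', dist_eq_norm] at h1
  have hpi : (π : ℂ) ≠ 0 := by exact_mod_cast pi_ne_zero
  have h3 : eval z (C (-(π : ℂ)⁻¹) * p) - f z = (π : ℂ)⁻¹ * (-π * f z - eval z p) := by
    simp only [eval_mul, eval_C]
    field_simp
    ring
  rw [h3, norm_mul, norm_inv, Complex.norm_real, Real.norm_of_nonneg pi_pos.le,
    inv_mul_lt_iff₀ pi_pos]
  exact h1

/-- In a simply connected open set, a bounded open set whose frontier lies in the set
lies in the set. -/
lemma subset_of_frontier_subset_of_isSimplyConnected {Ω V : Set ℂ} (hΩ : IsOpen Ω)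
    (hΩsc : IsSimplyConnected Ω) (hV : IsOpen V) (hVb : Bornology.IsBounded V)
    (hVf : frontier V ⊆ Ω) : V ⊆ Ω := by
  classical
  intro w hwV
  by_contra hwΩ
  obtain ⟨g, hgc, hg⟩ := Complex.exists_continuousOn_eqOn_exp_comp hΩsc hΩ
    (g := fun z => z - w) (by fun_prop) (by
      rintro ⟨z, hz, h⟩
      exact hwΩ (sub_eq_zero.1 h ▸ hz))
  have hC : IsClosed (V \ Ω) := by
    have : V \ Ω = closure V \ Ω := by
      ext z
      refine ⟨fun h => ⟨subset_closure h.1, h.2⟩, fun h => ⟨?_, h.2⟩⟩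
      by_contra hz
      exact h.2 (hVf ⟨h.1, fun h' => hz (interior_subset h')⟩)
    rw [this, Set.sdiff_eq]
    exact isClosed_closure.inter hΩ.isClosed_compl
  obtain ⟨φ, hφ0, hφ1, -⟩ := exists_contMDiffMap_zero_one_nhds_of_isClosed
    (n := 0) (modelWithCornersSelf ℝ ℂ) hV.isClosed_compl hC
    (Set.disjoint_left.2 fun z hz hz' => hz hz'.1)
  have hφ : Continuous φ := φ.contMDiff.continuous
  let E : ℂ → ℂ := fun z => if z ∈ V then Complex.exp ((1 - φ z) * g z) else z - w
  have hEc : Continuous E := by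
    rw [continuous_iff_continuousAt]
    intro z
    by_cases hzV : z ∈ V
    · by_cases hzΩ : z ∈ Ω
      · have h1 : ContinuousAt (fun z => Complex.exp ((1 - φ z) * g z)) z := by
          have := hgc.continuousAt (hΩ.mem_nhds hzΩ)
          have h2 : ContinuousAt (fun z => (φ z : ℂ)) z :=
            (Complex.continuous_ofReal.comp hφ).continuousAt
          fun_prop
        refine h1.congr ?_
        filter_upwards [hV.mem_nhds hzV] with v hv
        simp [E, hv]
      · refine (continuousAt_const (y := (1 : ℂ))).congr ?_
        filter_upwards [hV.mem_nhds hzV,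
          hφ1.filter_mono (nhds_le_nhdsSet (show z ∈ V \ Ω from ⟨hzV, hzΩ⟩))] with v hv hv'
        simp [E, hv, hv']
    · have h1 : ContinuousAt (fun z => z - w) z := by fun_prop
      refine h1.congr ?_
      filter_upwards [hφ0.filter_mono (nhds_le_nhdsSet (show z ∈ Vᶜ from hzV))] with v hv
      by_cases hvV : v ∈ V
      · have hvΩ : v ∈ Ω := by
          by_contra hvΩ
          have := hφ1.self_of_nhdsSet v ⟨hvV, hvΩ⟩
          rw [hv] at this
          norm_num at this
        have := hg hvΩ
        simp only [Function.comp_apply] at this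
        simp [E, hvV, hv, this]
      · simp [E, hvV]
  have hE0 : ∀ z, E z ≠ 0 := by
    intro z
    by_cases hzV : z ∈ V
    · simp [E, hzV]
    · simp only [E, hzV, if_false]
      exact fun h => hzV (sub_eq_zero.1 h ▸ hwV)
  have huniv : IsSimplyConnected (Set.univ : Set ℂ) := by
    have : ContractibleSpace (Set.univ : Set ℂ) :=
      (Homeomorph.Set.univ ℂ).contractibleSpace
    exact SimplyConnectedSpace.ofContractible _
  obtain ⟨L, hLc, hL⟩ := Complex.exists_continuousOn_eqOn_exp_comp huniv isOpen_univ
    (g := E) hEc.continuousOn (by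
      rintro ⟨z, -, h⟩
      exact hE0 z h)
  rw [continuousOn_univ] at hLc
  obtain ⟨R, hR⟩ := hVb.subset_closedBall w
  have hR0 : 0 < |R| + 1 := by positivity
  have hd : ∀ z ∈ sphere w (|R| + 1), HasDerivWithinAt L (z - w)⁻¹ (sphere w (|R| + 1)) z := by
    intro z hz
    have hzR : R < dist z w := by
      rw [mem_sphere.1 hz]
      linarith [le_abs_self R]
    have hev : ∀ᶠ v in 𝓝 z, Complex.exp (L v) = v - w := by
      filter_upwards [(continuous_id.dist continuous_const).continuousAt.eventually
        (lt_mem_nhds hzR)] with v hv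
      have hvV : v ∉ V := fun h => (not_le.2 hv) (mem_closedBall.1 (hR h))
      have := hL (Set.mem_univ v)
      simpa [E, hvV] using this
    have h1 := HasDerivAt.of_local_left_inverse (f := fun u => Complex.exp u + w) (g := L)
      hLc.continuousAt ((Complex.hasDerivAt_exp (L z)).add_const w) (Complex.exp_ne_zero _)
      (hev.mono fun v hv => by rw [hv]; ring)
    rw [hev.self_of_nhds] at h1
    exact h1.hasDerivWithinAt
  have h0 := circleIntegral.integral_eq_zero_of_hasDerivWithinAt hR0.le hd
  rw [circleIntegral.integral_sub_inv_of_mem_ball (mem_ball_self hR0)] at h0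
  exact Complex.two_pi_I_ne_zero h0

lemma frontier_connectedComponentIn_compl_subset {K : Set ℂ} (hK : IsClosed K) (w : ℂ) :
    frontier (connectedComponentIn Kᶜ w) ⊆ K := by
  intro v hv
  by_contra hvK
  have hvo : IsOpen (connectedComponentIn Kᶜ v) := hK.isOpen_compl.connectedComponentIn
  obtain ⟨u, hu, hu'⟩ := mem_closure_iff.1 hv.1 _ hvo (mem_connectedComponentIn hvK)
  have h1 := connectedComponentIn_eq hu
  have h2 := connectedComponentIn_eq hu'
  have h3 : IsOpen (connectedComponentIn Kᶜ w) := hK.isOpen_compl.connectedComponentIn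
  rw [frontier, h3.interior_eq] at hv
  exact hv.2 (h2 ▸ h1 ▸ mem_connectedComponentIn hvK)

/-- Runge's theorem in a simply connected open subset of the plane: holomorphic functions are
uniformly approximable by polynomials on compact subsets. -/
theorem exists_polynomial_near_of_isSimplyConnected {Ω K : Set ℂ} (hΩ : IsOpen Ω)
    (hΩsc : IsSimplyConnected Ω) (hK : IsCompact K) (hKΩ : K ⊆ Ω)
    {f : ℂ → ℂ} (hf : DifferentiableOn ℂ f Ω) {ε : ℝ} (hε : 0 < ε) :
    ∃ p : ℂ[X], ∀ z ∈ K, ‖p.eval z - f z‖ < ε := by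
  let H : Set ℂ := {z | Bornology.IsBounded (connectedComponentIn Kᶜ z)}
  have hHmem : ∀ z, z ∈ H ↔ Bornology.IsBounded (connectedComponentIn Kᶜ z) := fun z => by
    simp [H]
  have hKH : K ⊆ H := by
    intro z hz
    rw [hHmem, connectedComponentIn_eq_empty (not_not.2 hz)]
    exact Bornology.isBounded_empty
  have hcomp : ∀ z ∉ H, connectedComponentIn Kᶜ z ⊆ Hᶜ := by
    intro z hz v hv hvH
    rw [hHmem, ← connectedComponentIn_eq hv, ← hHmem] at hvH
    exact hz hvH
  have hself : ∀ z ∉ H, z ∈ connectedComponentIn Kᶜ z := fun z hz =>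
    mem_connectedComponentIn fun h => hz (hKH h)
  have hHcl : IsClosed H := by
    rw [← isOpen_compl_iff, isOpen_iff_mem_nhds]
    intro z hz
    exact mem_of_superset (hK.isClosed.isOpen_compl.connectedComponentIn.mem_nhds (hself z hz))
      (hcomp z hz)
  have hHb : Bornology.IsBounded H := by
    obtain ⟨R, hR⟩ := hK.isBounded.subset_closedBall 0
    refine (isBounded_closedBall (x := (0 : ℂ)) (r := |R|)).subset fun z hz => ?_
    rw [hHmem] at hz
    by_contra hzR
    have hzR' : |R| < ‖z‖ := by simpa using hzR
    have hz0 : 0 < ‖z‖ := (abs_nonneg R).trans_lt hzR'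
    have hray : IsPreconnected ((fun t : ℝ => (t : ℂ) * z) '' Set.Ici 1) :=
      isPreconnected_Ici.image _ (by fun_prop)
    have hsub := hray.subset_connectedComponentIn (F := Kᶜ) (x := z) ⟨1, by simp, by simp⟩ (by
      rintro _ ⟨t, ht, rfl⟩ h
      have h1 := hR h
      rw [mem_closedBall_zero_iff, norm_mul, Complex.norm_real, Real.norm_eq_abs] at h1
      have h2 : 1 ≤ |t| := le_trans ht (le_abs_self t)
      nlinarith [le_abs_self R])
    obtain ⟨M, hM⟩ := (hz.subset hsub).subset_closedBall 0
    have h1 := hM ⟨1 + |M| / ‖z‖, by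
      simp only [Set.mem_Ici, le_add_iff_nonneg_right]; positivity, rfl⟩
    rw [mem_closedBall_zero_iff, norm_mul, Complex.norm_real,
      Real.norm_of_nonneg (by positivity), add_mul, div_mul_cancel₀ _ hz0.ne'] at h1
    linarith [le_abs_self M]
  have hHΩ : H ⊆ Ω := by
    intro z hz
    by_cases hzK : z ∈ K
    · exact hKΩ hzK
    · exact subset_of_frontier_subset_of_isSimplyConnected hΩ hΩsc
        hK.isClosed.isOpen_compl.connectedComponentIn ((hHmem z).1 hz)
        ((frontier_connectedComponentIn_compl_subset hK.isClosed z).trans hKΩ)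
        (mem_connectedComponentIn hzK)
  obtain ⟨p, hp⟩ := exists_polynomial_near_of_unbounded_components hΩ
    (isCompact_of_isClosed_isBounded hHcl hHb) hHΩ (fun z hz hb => hz
      ((hHmem z).2 <| hb.subset (isPreconnected_connectedComponentIn.subset_connectedComponentIn
        (hself z hz) (hcomp z hz)))) hf hε
  exact ⟨p, fun z hz => hp z (hKH hz)⟩

/-- The Hankel matrix `(a_{m-n+1+i+j})_{0 ≤ i,j ≤ n-1}`. -/
def hankelMatrix (a : ℕ → ℂ) (m n : ℕ) : Matrix (Fin n) (Fin n) ℂ :=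
  Matrix.of fun i j : Fin n => acoefZ a ((m : ℤ) - n + 1 + i + j)

lemma coeff_mul_mk (a : ℕ → ℂ) (Q : ℂ[X]) (j : ℕ) :
    PowerSeries.coeff j ((Q : PowerSeries ℂ) * PowerSeries.mk a)
      = ∑ i ∈ Finset.range (j + 1), Q.coeff i * a (j - i) := by
  rw [PowerSeries.coeff_mul, Finset.Nat.sum_antidiagonal_eq_sum_range_succ_mk]
  simp

lemma coeff_mul_mk_of_degree_lt (a : ℕ → ℂ) {Q : ℂ[X]} {N : ℕ} (hQ : Q.degree < N) (j : ℕ) :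
    PowerSeries.coeff j ((Q : PowerSeries ℂ) * PowerSeries.mk a)
      = ∑ l ∈ Finset.range N, Q.coeff l * acoefZ a ((j : ℤ) - l) := by
  rw [coeff_mul_mk]
  have h1 : ∑ i ∈ Finset.range (j + 1), Q.coeff i * a (j - i)
      = ∑ i ∈ Finset.range (j + 1), Q.coeff i * acoefZ a ((j : ℤ) - i) := by
    refine Finset.sum_congr rfl fun i hi => ?_
    have hi' : i ≤ j := Nat.lt_succ_iff.1 (Finset.mem_range.1 hi)
    rw [acoefZ, if_pos (by omega)]
    congr 2
    omega
  rw [h1]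
  have h2 : ∀ M, N ≤ M → ∑ l ∈ Finset.range N, Q.coeff l * acoefZ a ((j : ℤ) - l)
      = ∑ l ∈ Finset.range M, Q.coeff l * acoefZ a ((j : ℤ) - l) := by
    intro M hM
    refine Finset.sum_subset (Finset.range_mono hM) fun l _ hl => ?_
    rw [coeff_eq_zero_of_degree_lt (hQ.trans_le ?_), zero_mul]
    exact_mod_cast not_lt.1 (fun h => hl (Finset.mem_range.2 h))
  rw [h2 (max N (j + 1)) (le_max_left _ _)]
  refine Finset.sum_subset (Finset.range_mono (le_max_right _ _)) fun l _ hl => ?_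
  have hl' : ¬ l < j + 1 := fun h => hl (Finset.mem_range.2 h)
  rw [acoefZ, if_neg (by omega), mul_zero]

lemma hankelMatrix_mulVec (a : ℕ → ℂ) (m : ℕ) {n : ℕ} {Q : ℂ[X]} (hQ : Q.degree < n) :
    (hankelMatrix a m n).mulVec (fun j => Q.coeff (Fin.rev j))
      = fun i : Fin n => PowerSeries.coeff (m + i) ((Q : PowerSeries ℂ) * PowerSeries.mk a) := by
  funext i
  rw [coeff_mul_mk_of_degree_lt a hQ, Finset.sum_range, Matrix.mulVec, dotProduct,
    ← Equiv.sum_comp Fin.revPerm]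
  refine Finset.sum_congr rfl fun l _ => ?_
  simp only [Fin.revPerm_apply, Fin.rev_rev, hankelMatrix, Matrix.of_apply]
  rw [mul_comm]
  congr 2
  rw [Fin.val_rev]
  have := l.2
  push_cast [Nat.cast_sub (show (l : ℕ) + 1 ≤ n from this)]
  ring

lemma eq_zero_of_coeff_mul_mk_eq_zero {a : ℕ → ℂ} {m n : ℕ} (h : hankelDet a m n ≠ 0)
    {Q : ℂ[X]} (hQ : Q.degree < n)
    (hc : ∀ i < n, PowerSeries.coeff (m + i) ((Q : PowerSeries ℂ) * PowerSeries.mk a) = 0) :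
    Q = 0 := by
  have h1 := hankelMatrix_mulVec a m hQ
  have h2 := Matrix.eq_zero_of_mulVec_eq_zero (M := hankelMatrix a m n) h
    (h1.trans (funext fun i => hc i i.2))
  ext l
  by_cases hl : l < n
  · simpa using congrFun h2 (Fin.rev ⟨l, hl⟩)
  · rw [coeff_eq_zero_of_degree_lt (hQ.trans_le (by exact_mod_cast not_lt.1 hl)), coeff_zero]

/-- The polynomial of degree `< n` with prescribed coefficients in decreasing order. -/
def revPoly {n : ℕ} (v : Fin n → ℂ) : ℂ[X] := ∑ j : Fin n, C (v (Fin.rev j)) * X ^ (j : ℕ)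

lemma revPoly_degree_lt {n : ℕ} (v : Fin n → ℂ) : (revPoly v).degree < n :=
  Polynomial.degree_sum_fin_lt fun j => v (Fin.rev j)

lemma revPoly_coeff_rev {n : ℕ} (v : Fin n → ℂ) (j : Fin n) :
    (revPoly v).coeff (Fin.rev j) = v j := by
  simp only [revPoly, finsetSum_coeff, coeff_C_mul, coeff_X_pow, ← Fin.ext_iff]
  simp

/-- The Padé denominator of type `(m, n)`, multiplied by the Hankel determinant. -/
def padeDen (a : ℕ → ℂ) (m n : ℕ) : ℂ[X] :=
  C (hankelDet a m n) +
    X * revPoly ((hankelMatrix a m n).cramer fun i : Fin n => -a (m + 1 + i))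

/-- The Padé numerator of type `(m, n)`, multiplied by the Hankel determinant. -/
def padeNum (a : ℕ → ℂ) (m n : ℕ) : ℂ[X] :=
  PowerSeries.trunc (m + 1) ((padeDen a m n : PowerSeries ℂ) * PowerSeries.mk a)

lemma padeDen_coeff_zero (a : ℕ → ℂ) (m n : ℕ) : (padeDen a m n).coeff 0 = hankelDet a m n := by
  simp [padeDen]

lemma padeDen_natDegree_le (a : ℕ → ℂ) (m n : ℕ) : (padeDen a m n).natDegree ≤ n := by
  rw [natDegree_le_iff_coeff_eq_zero]
  intro j hj
  obtain ⟨j, rfl⟩ : ∃ i, j = i + 1 := ⟨j - 1, by omega⟩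
  rw [padeDen, coeff_add, coeff_C_succ, coeff_X_mul, zero_add]
  exact coeff_eq_zero_of_degree_lt ((revPoly_degree_lt _).trans_le
    (by exact_mod_cast (by omega : n ≤ j)))

lemma padeNum_natDegree_le (a : ℕ → ℂ) (m n : ℕ) : (padeNum a m n).natDegree ≤ m :=
  Nat.lt_succ_iff.1 (PowerSeries.natDegree_trunc_lt _ m)

lemma coeff_X_mul_mul_mk (a : ℕ → ℂ) (Q : ℂ[X]) (j : ℕ) :
    PowerSeries.coeff (j + 1) (((X * Q : ℂ[X]) : PowerSeries ℂ) * PowerSeries.mk a)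
      = PowerSeries.coeff j ((Q : PowerSeries ℂ) * PowerSeries.mk a) := by
  rw [Polynomial.coe_mul, Polynomial.coe_X, mul_assoc, PowerSeries.coeff_succ_X_mul]

lemma coeff_C_mul_mul_mk (a : ℕ → ℂ) (Q : ℂ[X]) (c : ℂ) (j : ℕ) :
    PowerSeries.coeff j (((C c * Q : ℂ[X]) : PowerSeries ℂ) * PowerSeries.mk a)
      = c * PowerSeries.coeff j ((Q : PowerSeries ℂ) * PowerSeries.mk a) := by
  rw [Polynomial.coe_mul, Polynomial.coe_C, mul_assoc, PowerSeries.coeff_C_mul]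

lemma padeDen_mul_coeff (a : ℕ → ℂ) {m n j : ℕ} (hj : j ≤ m + n) :
    PowerSeries.coeff j ((padeDen a m n : PowerSeries ℂ) * PowerSeries.mk a)
      = (padeNum a m n).coeff j := by
  rw [padeNum, PowerSeries.coeff_trunc]
  split_ifs with h
  · rfl
  obtain ⟨i, rfl⟩ : ∃ i, j = m + i + 1 := ⟨j - m - 1, by omega⟩
  have hi : i < n := by omega
  have h1 := hankelMatrix_mulVec a m
    (revPoly_degree_lt ((hankelMatrix a m n).cramer fun i : Fin n => -a (m + 1 + i)))
  simp only [revPoly_coeff_rev, Matrix.mulVec_cramer] at h1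
  have h2 := congrFun h1 ⟨i, hi⟩
  rw [padeDen, Polynomial.coe_add, add_mul, map_add, coeff_X_mul_mul_mk, ← h2, Polynomial.coe_C,
    PowerSeries.coeff_C_mul, PowerSeries.coeff_mk, Pi.smul_apply, smul_eq_mul]
  change hankelDet a m n * _ + hankelDet a m n * _ = 0
  rw [show m + i + 1 = m + 1 + i by ring]
  ring

lemma isPade_iff {a : ℕ → ℂ} {m n : ℕ} {P Q : ℂ[X]} :
    IsPade a m n P Q ↔ P.natDegree ≤ m ∧ Q.natDegree ≤ n ∧ IsCoprime P Q ∧ Q.coeff 0 = 1 ∧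
      ∀ j ≤ m + n,
        PowerSeries.coeff j ((Q : PowerSeries ℂ) * PowerSeries.mk a) = P.coeff j := by
  simp only [coeff_mul_mk]
  rfl

lemma eq_of_isPade {a : ℕ → ℂ} {m n : ℕ} (h : hankelDet a m n ≠ 0) {P Q : ℂ[X]}
    (hPQ : IsPade a m n P Q) :
    padeNum a m n = C (hankelDet a m n) * P ∧ padeDen a m n = C (hankelDet a m n) * Q := by
  obtain ⟨hP, hQ, -, hQ0, hc⟩ := isPade_iff.1 hPQ
  set d := hankelDet a m n with hd
  have hden : padeDen a m n = C d * Q := by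
    set D := padeDen a m n - C d * Q with hD
    have h0 : D.coeff 0 = 0 := by simp [hD, padeDen_coeff_zero, hQ0, hd]
    obtain ⟨E, hE⟩ := X_dvd_iff.2 h0
    have hDdeg : D.natDegree ≤ n := by
      refine (natDegree_sub_le _ _).trans (max_le (padeDen_natDegree_le a m n) ?_)
      exact (natDegree_C_mul_le _ _).trans hQ
    have hEdeg : E.degree < n := by
      rw [degree_lt_iff_coeff_zero]
      intro j hj
      rw [← coeff_X_mul, ← hE]
      exact coeff_eq_zero_of_natDegree_lt (by omega)
    have hDc : ∀ j ≤ m + n, PowerSeries.coeff j ((D : PowerSeries ℂ) * PowerSeries.mk a)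
        = (padeNum a m n).coeff j - d * P.coeff j := by
      intro j hj
      rw [hD, Polynomial.coe_sub, sub_mul, map_sub, coeff_C_mul_mul_mk, hc j hj,
        padeDen_mul_coeff a hj]
    have hE0 := eq_zero_of_coeff_mul_mk_eq_zero h hEdeg (fun i hi => by
      rw [← coeff_X_mul_mul_mk, ← hE, hDc _ (by omega),
        coeff_eq_zero_of_natDegree_lt ((padeNum_natDegree_le a m n).trans_lt (by omega)),
        coeff_eq_zero_of_natDegree_lt (hP.trans_lt (by omega)), mul_zero, sub_zero])
    rw [hE0, mul_zero] at hE
    exact sub_eq_zero.1 hE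
  refine ⟨?_, hden⟩
  ext j
  rw [coeff_C_mul]
  by_cases hj : j ≤ m + n
  · rw [← padeDen_mul_coeff a hj, hden, coeff_C_mul_mul_mk, hc j hj]
  · rw [coeff_eq_zero_of_natDegree_lt ((padeNum_natDegree_le a m n).trans_lt (by omega)),
      coeff_eq_zero_of_natDegree_lt (hP.trans_lt (by omega)), mul_zero]

lemma isCoprime_of_hankelDet_ne_zero {a : ℕ → ℂ} {m n : ℕ}
    (h : hankelDet a m n ≠ 0) {P Q : ℂ[X]} (hP : P.natDegree ≤ m) (hQ : Q.natDegree ≤ n)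
    (hQ0 : Q.coeff 0 ≠ 0)
    (hc : ∀ j ≤ m + n,
      PowerSeries.coeff j ((Q : PowerSeries ℂ) * PowerSeries.mk a) = P.coeff j) :
    IsCoprime P Q := by
  refine isCoprime_of_irreducible_dvd (fun h => hQ0 (by simp [h.2])) ?_
  rintro D hD ⟨P₁, rfl⟩ ⟨Q₁, rfl⟩
  have hDdeg : 0 < D.natDegree := hD.natDegree_pos
  have hD0 : D.coeff 0 ≠ 0 := fun h0 => hQ0 (by simp [mul_coeff_zero, h0])
  have hQ₁0 : Q₁ ≠ 0 := fun h0 => hQ0 (by simp [h0])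
  have hP₁ : P₁.degree < m := by
    by_cases h0 : P₁ = 0
    · simp [h0]
    · rw [natDegree_mul hD.ne_zero h0] at hP
      rw [degree_eq_natDegree h0]
      exact_mod_cast (by omega : P₁.natDegree < m)
  have hQ₁ : Q₁.degree < n := by
    rw [natDegree_mul hD.ne_zero hQ₁0] at hQ
    rw [degree_eq_natDegree hQ₁0]
    exact_mod_cast (by omega : Q₁.natDegree < n)
  have hdvd : (PowerSeries.X : PowerSeries ℂ) ^ (m + n) ∣
      (D : PowerSeries ℂ) * ((Q₁ : PowerSeries ℂ) * PowerSeries.mk a - P₁) := by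
    rw [PowerSeries.X_pow_dvd_iff]
    intro j hj
    have := hc j hj.le
    rw [mul_sub, ← mul_assoc, ← Polynomial.coe_mul, ← Polynomial.coe_mul, map_sub, this,
      Polynomial.coeff_coe, sub_self]
  have hDu : IsUnit (D : PowerSeries ℂ) := by
    rw [PowerSeries.isUnit_iff_constantCoeff, isUnit_iff_ne_zero]
    simpa using hD0
  rw [hDu.dvd_mul_left, PowerSeries.X_pow_dvd_iff] at hdvd
  refine hQ₁0 (eq_zero_of_coeff_mul_mk_eq_zero h hQ₁ fun i hi => ?_)
  have := hdvd (m + i) (by omega)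
  rw [map_sub, Polynomial.coeff_coe, coeff_eq_zero_of_degree_lt (hP₁.trans_le
    (by exact_mod_cast (by omega : m ≤ m + i))), sub_zero] at this
  exact this

lemma isPade_of_hankelDet_ne_zero {a : ℕ → ℂ} {m n : ℕ}
    (h : hankelDet a m n ≠ 0) :
    IsPade a m n (C (hankelDet a m n)⁻¹ * padeNum a m n)
      (C (hankelDet a m n)⁻¹ * padeDen a m n) := by
  have h1 := (natDegree_C_mul_le (hankelDet a m n)⁻¹ _).trans (padeNum_natDegree_le a m n)
  have h2 := (natDegree_C_mul_le (hankelDet a m n)⁻¹ _).trans (padeDen_natDegree_le a m n)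
  have h3 : (C (hankelDet a m n)⁻¹ * padeDen a m n).coeff 0 = 1 := by
    rw [coeff_C_mul, padeDen_coeff_zero, inv_mul_cancel₀ h]
  have h4 : ∀ j ≤ m + n, PowerSeries.coeff j
      (((C (hankelDet a m n)⁻¹ * padeDen a m n : ℂ[X]) : PowerSeries ℂ) * PowerSeries.mk a)
        = (C (hankelDet a m n)⁻¹ * padeNum a m n).coeff j := by
    intro j hj
    rw [coeff_C_mul_mul_mk, padeDen_mul_coeff a hj, coeff_C_mul]
  exact isPade_iff.2 ⟨h1, h2, isCoprime_of_hankelDet_ne_zero h h1 h2 (by simp [h3]) h4, h3, h4⟩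

lemma mem_Nset_iff {a : ℕ → ℂ} {m n : ℕ} :
    a ∈ Nset m n ↔ hankelDet a m n ≠ 0 ∧ (padeDen a m n).coeff n ≠ 0 := by
  simp only [Nset, Set.mem_ofPred_eq]
  refine and_congr_right fun h => ⟨?_, fun h2 => ⟨_, _, isPade_of_hankelDet_ne_zero h, ?_⟩⟩
  · rintro ⟨P, Q, hPQ, hQ⟩
    rw [(eq_of_isPade h hPQ).2, coeff_C_mul]
    exact mul_ne_zero h (coeff_ne_zero_of_eq_degree hQ)
  · refine degree_eq_of_le_of_coeff_ne_zero ?_ ?_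
    · exact degree_le_of_natDegree_le
        ((natDegree_C_mul_le _ _).trans (padeDen_natDegree_le a m n))
    · rw [coeff_C_mul]
      exact mul_ne_zero (inv_ne_zero h) h2

lemma hankelDet_ne_zero_of_isPade {a : ℕ → ℂ} {m n : ℕ} {P Q : ℂ[X]}
    (hPQ : IsPade a m n P Q) (hn : Q.degree = n) : hankelDet a m n ≠ 0 := by
  obtain ⟨hP, -, hcop, -, hc⟩ := isPade_iff.1 hPQ
  intro h0
  obtain ⟨v, hv0, hv⟩ := Matrix.exists_mulVec_eq_zero_iff.2
    (show (hankelMatrix a m n).det = 0 from h0)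
  have h1 := hankelMatrix_mulVec a m (revPoly_degree_lt v)
  simp only [revPoly_coeff_rev] at h1
  rw [hv] at h1
  have hR := revPoly_degree_lt v
  set R := revPoly v with hRdef
  have hR0 : R ≠ 0 := by
    contrapose! hv0
    funext j
    rw [← revPoly_coeff_rev v j, ← hRdef, hv0]
    simp
  set T := PowerSeries.trunc m ((R : PowerSeries ℂ) * PowerSeries.mk a) with hT
  have hTdeg : T.degree < m := PowerSeries.degree_trunc_lt _ m
  have e1 : (PowerSeries.X : PowerSeries ℂ) ^ (m + n) ∣
      (T : PowerSeries ℂ) - (R : PowerSeries ℂ) * PowerSeries.mk a := by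
    rw [PowerSeries.X_pow_dvd_iff]
    intro j hj
    rw [map_sub, Polynomial.coeff_coe, hT, PowerSeries.coeff_trunc]
    split_ifs with hjm
    · exact sub_self _
    · have := congrFun h1 ⟨j - m, by omega⟩
      simp only [Pi.zero_apply] at this
      rw [show m + (j - m) = j by omega] at this
      rw [← this, sub_zero]
  have e2 : (PowerSeries.X : PowerSeries ℂ) ^ (m + n) ∣
      (P : PowerSeries ℂ) - (Q : PowerSeries ℂ) * PowerSeries.mk a := by
    rw [PowerSeries.X_pow_dvd_iff]
    intro j hj
    rw [map_sub, Polynomial.coeff_coe, hc j hj.le, sub_self]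
  have e3 : (PowerSeries.X : PowerSeries ℂ) ^ (m + n) ∣
      ((T * Q - R * P : ℂ[X]) : PowerSeries ℂ) := by
    have : ((T * Q - R * P : ℂ[X]) : PowerSeries ℂ) =
        ((T : PowerSeries ℂ) - (R : PowerSeries ℂ) * PowerSeries.mk a) * Q -
        ((P : PowerSeries ℂ) - (Q : PowerSeries ℂ) * PowerSeries.mk a) * R := by
      push_cast
      ring
    rw [this]
    exact dvd_sub (e1.mul_right _) (e2.mul_right _)
  rw [PowerSeries.X_pow_dvd_iff] at e3
  have e4 : T * Q - R * P = 0 := by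
    have hd : (T * Q - R * P).degree < (m + n : ℕ) := by
      refine (degree_sub_le _ _).trans_lt (max_lt ?_ ?_)
      · by_cases hT0 : T = 0
        · simp [hT0]
        · have hQ0 : Q ≠ 0 := fun h => by simp [h] at hn
          rw [degree_eq_natDegree hT0] at hTdeg
          rw [degree_eq_natDegree hQ0] at hn
          rw [degree_mul, degree_eq_natDegree hT0, degree_eq_natDegree hQ0]
          norm_cast at *
          omega
      · by_cases hP0 : P = 0
        · simp [hP0]
        · rw [degree_eq_natDegree hR0] at hR
          rw [degree_mul, degree_eq_natDegree hR0, degree_eq_natDegree hP0]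
          norm_cast at *
          omega
    ext j
    by_cases hj : j < m + n
    · have := e3 j hj
      rwa [Polynomial.coeff_coe] at this
    · rw [coeff_eq_zero_of_degree_lt (hd.trans_le (by exact_mod_cast not_lt.1 hj)), coeff_zero]
  have e5 : Q ∣ R * P := ⟨T, by rw [← sub_eq_zero.1 e4, mul_comm]⟩
  have e6 : Q ∣ R := hcop.symm.dvd_of_dvd_mul_right e5
  have := degree_le_of_dvd e6 hR0
  rw [hn] at this
  exact absurd hR (not_lt.2 this)

lemma continuous_hankelMatrix (m n : ℕ) : Continuous fun a : ℕ → ℂ => hankelMatrix a m n := by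
  refine continuous_matrix fun i j => ?_
  simp only [hankelMatrix, Matrix.of_apply, acoefZ]
  split_ifs <;> fun_prop

lemma continuous_hankelDet (m n : ℕ) : Continuous fun a : ℕ → ℂ => hankelDet a m n :=
  (continuous_hankelMatrix m n).matrix_det

lemma continuous_padeDen_coeff (m n j : ℕ) :
    Continuous fun a : ℕ → ℂ => (padeDen a m n).coeff j := by
  have h1 : Continuous fun a : ℕ → ℂ =>
      (hankelMatrix a m n).cramer fun i : Fin n => -a (m + 1 + i) :=
    (continuous_hankelMatrix m n).matrix_cramer (by fun_prop)
  cases j with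
  | zero => simpa only [padeDen_coeff_zero] using continuous_hankelDet m n
  | succ j =>
    simp only [padeDen, coeff_add, coeff_C_succ, coeff_X_mul, zero_add, revPoly, finsetSum_coeff,
      coeff_C_mul, coeff_X_pow]
    fun_prop

lemma continuous_padeNum_coeff (m n j : ℕ) :
    Continuous fun a : ℕ → ℂ => (padeNum a m n).coeff j := by
  simp only [padeNum, PowerSeries.coeff_trunc, coeff_mul_mk]
  split_ifs
  · have := continuous_padeDen_coeff m n
    fun_prop
  · exact continuous_const

lemma continuous_eval_of_continuous_coeff {X : Type*} [TopologicalSpace X] {p : X → ℂ[X]}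
    {N : ℕ} (hN : ∀ x, (p x).natDegree ≤ N) (hc : ∀ j, Continuous fun x => (p x).coeff j) :
    Continuous fun y : X × ℂ => (p y.1).eval y.2 := by
  have h : ∀ y : X × ℂ,
      (p y.1).eval y.2 = ∑ j ∈ Finset.range (N + 1), (p y.1).coeff j * y.2 ^ j := fun y =>
    eval_eq_sum_range' (Nat.lt_succ_iff.2 (hN y.1)) y.2
  simp only [h]
  refine continuous_finsetSum _ fun j _ => ?_
  exact ((hc j).comp continuous_fst).mul (continuous_snd.pow j)

/-- The restriction to `Ω` of a holomorphic function on `Ω`, as a continuous map. -/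
def holToContinuousMap (Ω : Set ℂ) (f : Hol Ω) : C(Ω, ℂ) :=
  ⟨fun z => f.1 z, continuousOn_iff_continuous_domRestrict.1 f.2.1.continuousOn⟩

lemma isInducing_holToContinuousMap (Ω : Set ℂ) : IsInducing (holToContinuousMap Ω) :=
  ContinuousMap.isUniformEmbedding_toUniformOnFunIsCompact.isInducing.of_comp_iff.1 ⟨rfl⟩

lemma injective_holToContinuousMap (Ω : Set ℂ) : Function.Injective (holToContinuousMap Ω) := by
  intro f g h
  refine Subtype.ext (funext fun z => ?_)
  by_cases hz : z ∈ Ω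
  · exact congrArg (fun u : C(Ω, ℂ) => u ⟨z, hz⟩) h
  · rw [f.2.2 z hz, g.2.2 z hz]

lemma tendsto_hol_iff {Ω : Set ℂ} (hΩ : IsOpen Ω) {ι : Type*} {l : Filter ι} {F : ι → Hol Ω}
    {f : Hol Ω} :
    Tendsto F l (𝓝 f) ↔ TendstoLocallyUniformlyOn (fun i => (F i).1) f.1 l Ω := by
  have := hΩ.locallyCompactSpace
  rw [(isInducing_holToContinuousMap Ω).tendsto_nhds_iff,
    ContinuousMap.tendsto_iff_tendstoLocallyUniformly,
    tendstoLocallyUniformlyOn_iff_tendstoLocallyUniformly_comp_coe]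
  rfl

lemma isClosedEmbedding_holToContinuousMap {Ω : Set ℂ} (hΩ : IsOpen Ω) :
    IsClosedEmbedding (holToContinuousMap Ω) := by
  have := hΩ.locallyCompactSpace
  refine ⟨⟨isInducing_holToContinuousMap Ω, injective_holToContinuousMap Ω⟩, ?_⟩
  refine isClosed_iff_ultrafilter.2 fun u l hl hu => ?_
  have h : ∀ v : C(Ω, ℂ), ∃ f : ℂ → ℂ, (∀ z : Ω, f z = v z) ∧ ∀ z ∉ Ω, f z = 0 := by
    classical
    intro v
    refine ⟨fun z => if hz : z ∈ Ω then v ⟨z, hz⟩ else 0, fun z => by simp, fun z hz => ?_⟩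
    simp [hz]
  choose ext hext hext0 using h
  have hlim : TendstoLocallyUniformlyOn ext (ext u) l Ω := by
    rw [tendstoLocallyUniformlyOn_iff_tendstoLocallyUniformly_comp_coe]
    have := ContinuousMap.tendsto_iff_tendstoLocallyUniformly.1
      (show Tendsto (fun v : C(Ω, ℂ) => v) l (𝓝 u) from hl)
    convert this using 2 with v
    · exact funext fun z => hext v z
    · exact funext fun z => hext u z
  have hdiff : DifferentiableOn ℂ (ext u) Ω := by
    refine hlim.differentiableOn ?_ hΩ
    filter_upwards [hu]
    rintro _ ⟨f, rfl⟩
    exact f.2.1.congr fun z hz => hext (holToContinuousMap Ω f) ⟨z, hz⟩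
  exact ⟨⟨ext u, hdiff, hext0 u⟩, ContinuousMap.ext fun z => hext u z⟩

lemma baireSpace_hol {Ω : Set ℂ} (hΩ : IsOpen Ω) : BaireSpace (Hol Ω) := by
  have := hΩ.locallyCompactSpace
  have : TopologicalSpace.IsCompletelyMetrizableSpace C(Ω, ℂ) := inferInstance
  have := (isClosedEmbedding_holToContinuousMap hΩ).IsCompletelyMetrizableSpace
  infer_instance

lemma continuous_hol_eval {Ω : Set ℂ} (hΩ : IsOpen Ω) :
    Continuous fun y : Hol Ω × Ω => y.1.1 y.2 := by
  have := hΩ.locallyCompactSpace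
  have h : Continuous fun y : Hol Ω × Ω => holToContinuousMap Ω y.1 y.2 :=
    ((isInducing_holToContinuousMap Ω).continuous.comp continuous_fst).eval continuous_snd
  exact h

lemma differentiableOn_iteratedDeriv {Ω : Set ℂ} (hΩ : IsOpen Ω) {f : ℂ → ℂ}
    (hf : DifferentiableOn ℂ f Ω) (k : ℕ) : DifferentiableOn ℂ (iteratedDeriv k f) Ω := by
  induction k with
  | zero => simpa using hf
  | succ k ih =>
    rw [iteratedDeriv_succ]
    exact ih.deriv hΩ

lemma TendstoLocallyUniformlyOn.iteratedDeriv {Ω : Set ℂ} (hΩ : IsOpen Ω) {ι : Type*}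
    {l : Filter ι} {F : ι → ℂ → ℂ} {f : ℂ → ℂ} (h : TendstoLocallyUniformlyOn F f l Ω)
    (hF : ∀ i, DifferentiableOn ℂ (F i) Ω) (k : ℕ) :
    TendstoLocallyUniformlyOn (fun i => iteratedDeriv k (F i)) (iteratedDeriv k f) l Ω := by
  induction k with
  | zero => simpa using h
  | succ k ih =>
    simp only [iteratedDeriv_succ]
    exact ih.deriv (Eventually.of_forall fun i => differentiableOn_iteratedDeriv hΩ (hF i) k) hΩ

lemma continuous_tc {Ω : Set ℂ} (hΩ : IsOpen Ω) (h0 : (0 : ℂ) ∈ Ω) :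
    Continuous fun f : Hol Ω => tc f.1 := by
  refine continuous_pi fun k => Continuous.div_const (continuous_iff_continuousAt.2 fun f => ?_) _
  have h := (tendsto_hol_iff hΩ).1 (tendsto_id (x := 𝓝 f))
  exact (TendstoLocallyUniformlyOn.iteratedDeriv hΩ h (fun g => g.2.1) k).tendsto_at h0

lemma exists_compact_exhaustion {Ω : Set ℂ} (hΩ : IsOpen Ω) :
    ∃ K : ℕ → Set ℂ, Monotone K ∧ (∀ j, IsCompact (K j)) ∧ (∀ j, K j ⊆ Ω) ∧
      (∀ j, K j ⊆ interior (K (j + 1))) ∧ ∀ L ⊆ Ω, IsCompact L → ∃ j, L ⊆ K j := by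
  have := hΩ.locallyCompactSpace
  let E := CompactExhaustion.choice Ω
  refine ⟨fun j => Subtype.val '' E j, fun i j h => Set.image_mono (E.subset h),
    fun j => (E.isCompact j).image continuous_subtype_val,
    fun j => Subtype.coe_image_subset _ _, fun j => ?_, fun L hL hLc => ?_⟩
  · exact (Set.image_mono (E.subset_interior_succ j)).trans
      (hΩ.isOpenMap_subtype_val.image_interior_subset _)
  · obtain ⟨j, hj⟩ := E.exists_superset_of_isCompact
      (hΩ.isOpenEmbedding_subtypeVal.isInducing.isCompact_preimage' hLc (by simpa using hL))
    exact ⟨j, fun z hz => ⟨⟨z, hL hz⟩, hj hz, rfl⟩⟩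

/-- The functions of `𝒩_{m,n}` whose Padé approximant of type `(m, n)` is `ε`-close to them
on `K`. -/
def padeNearSet (Ω K : Set ℂ) (ε : ℝ) (m n : ℕ) : Set (Hol Ω) :=
  {f | (hankelDet (tc f.1) m n ≠ 0 ∧ (padeDen (tc f.1) m n).coeff n ≠ 0) ∧
    ∀ z ∈ K, ‖(padeNum (tc f.1) m n).eval z - f.1 z * (padeDen (tc f.1) m n).eval z‖
      < ε * ‖(padeDen (tc f.1) m n).eval z‖}

lemma mem_padeNearSet {Ω K : Set ℂ} {ε : ℝ} {m n : ℕ} {f : Hol Ω} :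
    f ∈ padeNearSet Ω K ε m n ↔
      (hankelDet (tc f.1) m n ≠ 0 ∧ (padeDen (tc f.1) m n).coeff n ≠ 0) ∧
        ∀ z ∈ K, ‖(padeNum (tc f.1) m n).eval z - f.1 z * (padeDen (tc f.1) m n).eval z‖
          < ε * ‖(padeDen (tc f.1) m n).eval z‖ := Iff.rfl

lemma isOpen_padeNearSet {Ω K : Set ℂ} (hΩ : IsOpen Ω) (h0 : (0 : ℂ) ∈ Ω) (hK : IsCompact K)
    (hKΩ : K ⊆ Ω) (ε : ℝ) (m n : ℕ) : IsOpen (padeNearSet Ω K ε m n) := by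
  have htc := continuous_tc hΩ h0
  have h1 : IsOpen {f : Hol Ω | hankelDet (tc f.1) m n ≠ 0} :=
    isOpen_ne_fun ((continuous_hankelDet m n).comp htc) continuous_const
  have h2 : IsOpen {f : Hol Ω | (padeDen (tc f.1) m n).coeff n ≠ 0} :=
    isOpen_ne_fun ((continuous_padeDen_coeff m n n).comp htc) continuous_const
  refine (h1.inter h2).inter (isOpen_iff_eventually.2 fun f hf => ?_)
  have hnum : Continuous fun y : Hol Ω × Ω => (padeNum (tc y.1.1) m n).eval (y.2 : ℂ) :=
    (continuous_eval_of_continuous_coeff (fun a => padeNum_natDegree_le a m n)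
      (continuous_padeNum_coeff m n)).comp
        ((htc.comp continuous_fst).prodMk (continuous_subtype_val.comp continuous_snd))
  have hden : Continuous fun y : Hol Ω × Ω => (padeDen (tc y.1.1) m n).eval (y.2 : ℂ) :=
    (continuous_eval_of_continuous_coeff (fun a => padeDen_natDegree_le a m n)
      (continuous_padeDen_coeff m n)).comp
        ((htc.comp continuous_fst).prodMk (continuous_subtype_val.comp continuous_snd))
  have hev := continuous_hol_eval hΩ
  have hopen : IsOpen {y : Hol Ω × Ω | ‖(padeNum (tc y.1.1) m n).eval (y.2 : ℂ) -
      y.1.1 y.2 * (padeDen (tc y.1.1) m n).eval (y.2 : ℂ)‖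
        < ε * ‖(padeDen (tc y.1.1) m n).eval (y.2 : ℂ)‖} :=
    isOpen_lt (hnum.sub (hev.mul hden)).norm (continuous_const.mul hden.norm)
  have hK' : IsCompact ((↑) ⁻¹' K : Set Ω) :=
    hΩ.isOpenEmbedding_subtypeVal.isInducing.isCompact_preimage' hK (by simpa using hKΩ)
  have := hK'.eventually_forall_of_forall_eventually (x₀ := f)
    (P := fun (g : Hol Ω) (z : Ω) => ‖(padeNum (tc g.1) m n).eval (z : ℂ) -
      g.1 z * (padeDen (tc g.1) m n).eval (z : ℂ)‖
        < ε * ‖(padeDen (tc g.1) m n).eval (z : ℂ)‖)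
    (fun z hz => hopen.mem_nhds (x := (f, z)) (hf z hz))
  filter_upwards [this] with g hg z hz
  exact hg ⟨z, hKΩ hz⟩ hz

lemma eval_ne_zero_of_norm_div_sub_le {P Q : ℂ[X]} (hPQ : IsCoprime P Q) (hQ : Q ≠ 0)
    {f : ℂ → ℂ} {z : ℂ} (hf : ContinuousAt f z) {ε : ℝ}
    (h : ∀ᶠ w in 𝓝 z, ‖f w - P.eval w / Q.eval w‖ ≤ ε) : Q.eval z ≠ 0 := by
  intro hz
  have hroot : ∀ᶠ w in 𝓝[≠] z, Q.eval w ≠ 0 :=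
    (show ∀ᶠ w in cofinite, ¬ Q.IsRoot w from
      (finite_setOfPred_isRoot hQ).compl_mem_cofinite).filter_mono (nhdsNE_le_cofinite z)
  have hle : ∀ᶠ w in 𝓝[≠] z, ‖f w * Q.eval w - P.eval w‖ ≤ ε * ‖Q.eval w‖ := by
    filter_upwards [hroot, h.filter_mono nhdsWithin_le_nhds] with w hw hwε
    calc ‖f w * Q.eval w - P.eval w‖ = ‖f w - P.eval w / Q.eval w‖ * ‖Q.eval w‖ := by
          rw [← norm_mul, sub_mul, div_mul_cancel₀ _ hw]
      _ ≤ ε * ‖Q.eval w‖ := by gcongr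
  have hlim := le_of_tendsto_of_tendsto
    (((hf.mul Q.continuous.continuousAt).sub P.continuous.continuousAt).norm.tendsto.mono_left
      nhdsWithin_le_nhds)
    ((Q.continuous.continuousAt.norm.const_mul ε).tendsto.mono_left nhdsWithin_le_nhds) hle
  have hPz : P.eval z = 0 := by simpa [hz] using hlim
  obtain ⟨u, v, huv⟩ := hPQ
  simpa [hz, hPz] using congrArg (eval z) huv

lemma exists_mem_padeNearSet {Ω K L : Set ℂ} (hΩ : IsOpen Ω) (hLΩ : L ⊆ Ω)
    (hKL : K ⊆ interior L) (hL : IsCompact L) {ε : ℝ} (hε : 0 < ε) {m n : ℕ → ℕ} {f : Hol Ω}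
    {P Q : ℕ → ℂ[X]}
    (hN : ∀ k, tc f.1 ∈ Nset (m k) (n k) ∧ IsPade (tc f.1) (m k) (n k) (P k) (Q k))
    (hlim : TendstoLocallyUniformlyOn (fun k z => (P k).eval z / (Q k).eval z) f.1 atTop Ω) :
    ∀ᶠ k in atTop, f ∈ padeNearSet Ω K ε (m k) (n k) := by
  have hu := Metric.tendstoUniformlyOn_iff.1
    ((tendstoLocallyUniformlyOn_iff_forall_isCompact hΩ).1 hlim L hLΩ hL) ε hε
  filter_upwards [hu] with k hk
  obtain ⟨hNk, hPQ⟩ := hN k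
  have hdet := mem_Nset_iff.1 hNk
  refine mem_padeNearSet.2 ⟨hdet, fun z hz => ?_⟩
  obtain ⟨h1, h2⟩ := eq_of_isPade hdet.1 hPQ
  have hzL := interior_subset (hKL hz)
  have hQ0 : Q k ≠ 0 := fun h => by simpa [h] using hPQ.2.2.2.1
  have hQz : (Q k).eval z ≠ 0 := by
    refine eval_ne_zero_of_norm_div_sub_le hPQ.2.2.1 hQ0 (ε := ε)
      (f.2.1.continuousOn.continuousAt (hΩ.mem_nhds (hLΩ hzL))) ?_
    filter_upwards [mem_interior_iff_mem_nhds.1 (hKL hz)] with w hw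
    rw [← dist_eq_norm]
    exact (hk w hw).le
  have hkz := hk z hzL
  rw [dist_eq_norm, norm_sub_rev] at hkz
  rw [h1, h2, eval_C_mul, eval_C_mul, norm_mul]
  set d := hankelDet (tc f.1) (m k) (n k)
  calc ‖d * (P k).eval z - f.1 z * (d * (Q k).eval z)‖
      = ‖(P k).eval z / (Q k).eval z - f.1 z‖ * (‖d‖ * ‖(Q k).eval z‖) := by
        rw [← norm_mul, ← norm_mul]
        congr 1
        field_simp
    _ < ε * (‖d‖ * ‖(Q k).eval z‖) := by
        have := norm_pos_iff.2 hdet.1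
        have := norm_pos_iff.2 hQz
        gcongr

lemma dist_div_lt_of_mem_padeNearSet {Ω K : Set ℂ} {ε : ℝ} (hε : 0 ≤ ε) {m n : ℕ} {f : Hol Ω}
    (h : f ∈ padeNearSet Ω K ε m n) {z : ℂ} (hz : z ∈ K) :
    dist (f.1 z) ((C (hankelDet (tc f.1) m n)⁻¹ * padeNum (tc f.1) m n).eval z /
      (C (hankelDet (tc f.1) m n)⁻¹ * padeDen (tc f.1) m n).eval z) < ε := by
  obtain ⟨⟨hd, -⟩, h⟩ := h
  have h := h z hz
  have hpos : 0 < ‖(padeDen (tc f.1) m n).eval z‖ :=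
    pos_of_mul_pos_right ((norm_nonneg _).trans_lt h) hε
  have hne := norm_pos_iff.1 hpos
  rw [eval_C_mul, eval_C_mul, mul_div_mul_left _ _ (inv_ne_zero hd), dist_eq_norm, norm_sub_rev,
    ← mul_lt_mul_iff_of_pos_right hpos, ← norm_mul, sub_mul, div_mul_cancel₀ _ hne]
  exact h

/-- The restriction to `Ω` of a polynomial function. -/
def polyHol (Ω : Set ℂ) (p : ℂ[X]) : Hol Ω :=
  ⟨Ω.indicator fun z => p.eval z,
    p.differentiable.differentiableOn.congr fun _ hz => Set.indicator_of_mem hz _,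
    fun _ hz => Set.indicator_of_notMem hz _⟩

lemma polyHol_apply {Ω : Set ℂ} (p : ℂ[X]) {z : ℂ} (hz : z ∈ Ω) :
    (polyHol Ω p).1 z = p.eval z :=
  Set.indicator_of_mem hz fun z => p.eval z

lemma iteratedDeriv_eval (p : ℂ[X]) (k : ℕ) :
    iteratedDeriv k (fun z => p.eval z) = fun z => (derivative^[k] p).eval z := by
  induction k with
  | zero => simp
  | succ k ih =>
    rw [iteratedDeriv_succ, ih, Function.iterate_succ_apply']
    exact funext fun z => Polynomial.deriv _

lemma tc_polyHol {Ω : Set ℂ} (hΩ : IsOpen Ω) (h0 : (0 : ℂ) ∈ Ω) (p : ℂ[X]) :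
    tc (polyHol Ω p).1 = p.coeff := by
  funext k
  have h : (polyHol Ω p).1 =ᶠ[𝓝 0] fun z => p.eval z :=
    (hΩ.eventually_mem h0).mono fun z hz => polyHol_apply p hz
  rw [tc, h.iteratedDeriv_eq, iteratedDeriv_eval]
  simp only [← coeff_zero_eq_eval_zero, coeff_iterate_derivative, zero_add,
    Nat.descFactorial_self, nsmul_eq_mul]
  exact mul_div_cancel_left₀ _ (by exact_mod_cast k.factorial_ne_zero)

lemma exists_isPade_near (p : ℂ[X]) {K : Set ℂ} (hK : IsCompact K) {ε η : ℝ} (hε : 0 < ε)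
    (hη : 0 < η) {m n : ℕ} (hm : p.natDegree ≤ m) (hn : 0 < n) :
    ∃ g A B : ℂ[X], IsPade g.coeff m n A B ∧ B.degree = n ∧
      (∀ z ∈ K, ‖g.eval z - p.eval z‖ < ε) ∧
      ∀ z ∈ K, ‖A.eval z - g.eval z * B.eval z‖ < η * ‖B.eval z‖ := by
  set N := m + n + 1 with hN
  let A : ℂ → ℂ[X] := fun c => p + C c
  let B : ℂ → ℂ[X] := fun δ => 1 + C δ * X ^ n
  let g : ℂ → ℂ → ℂ[X] := fun δ c => A c * ∑ l ∈ Finset.range N, (C (-δ) * X ^ n) ^ l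
  have evA : ∀ c z, (A c).eval z = p.eval z + c := fun c z => by simp [A]
  have evB : ∀ δ z, (B δ).eval z = 1 + δ * z ^ n := fun δ z => by simp [B]
  have evg : ∀ δ c z, (g δ c).eval z =
      (p.eval z + c) * ∑ l ∈ Finset.range N, (-δ * z ^ n) ^ l := fun δ c z => by
    simp [g, evA, eval_finsetSum]
  have hp : Continuous fun y : (ℂ × ℂ) × ℂ => p.eval y.2 := p.continuous.comp continuous_snd
  have hsum : ∀ z : ℂ, ∑ l ∈ Finset.range N, (-(0 : ℂ) * z ^ n) ^ l = 1 := by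
    intro z
    rw [hN, Finset.sum_range_succ']
    simp
  have hnear : ∀ᶠ x : ℂ × ℂ in 𝓝 (0, 0), ∀ z ∈ K,
      ‖(g x.1 x.2).eval z - p.eval z‖ < ε ∧
      ‖(A x.2).eval z - (g x.1 x.2).eval z * (B x.1).eval z‖ < η * ‖(B x.1).eval z‖ := by
    refine hK.eventually_forall_of_forall_eventually fun z _ => ?_
    simp only [evA, evB, evg]
    refine Filter.Eventually.and ?_ ?_
    · refine (isOpen_lt (f := fun y : (ℂ × ℂ) × ℂ =>
        ‖(p.eval y.2 + y.1.2) * ∑ l ∈ Finset.range N, (-y.1.1 * y.2 ^ n) ^ l - p.eval y.2‖)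
        (g := fun _ => ε) (by fun_prop) (by fun_prop)).mem_nhds ?_
      simpa [hsum] using hε
    · refine (isOpen_lt (f := fun y : (ℂ × ℂ) × ℂ => ‖p.eval y.2 + y.1.2 -
        (p.eval y.2 + y.1.2) * (∑ l ∈ Finset.range N, (-y.1.1 * y.2 ^ n) ^ l) *
          (1 + y.1.1 * y.2 ^ n)‖)
        (g := fun y => η * ‖1 + y.1.1 * y.2 ^ n‖) (by fun_prop) (by fun_prop)).mem_nhds ?_
      simpa [hsum] using hη
  rw [nhds_prod_eq] at hnear
  obtain ⟨δ, hδ, hδ0⟩ := ((hnear.curry.filter_mono nhdsWithin_le_nhds).and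
    (self_mem_nhdsWithin (s := {(0 : ℂ)}ᶜ))).exists
  have hBdeg : (B δ).degree = n := by
    have h1 : (C δ * X ^ n : ℂ[X]).degree = n := degree_C_mul_X_pow n hδ0
    rw [← h1]
    refine degree_add_eq_right_of_degree_lt ?_
    rw [h1, degree_one]
    exact_mod_cast hn
  have hB0 : B δ ≠ 0 := fun h => by simp [h] at hBdeg
  have hfin : ((fun w => -p.eval w) '' {w | (B δ).IsRoot w}).Finite :=
    (finite_setOfPred_isRoot hB0).image _
  obtain ⟨c, hc, hcB⟩ := ((hδ.filter_mono nhdsWithin_le_nhds).and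
    (nhdsNE_le_cofinite (0 : ℂ) hfin.compl_mem_cofinite)).exists
  refine ⟨g δ c, A c, B δ, isPade_iff.2 ⟨?_, natDegree_le_of_degree_le hBdeg.le, ?_, ?_, ?_⟩,
    hBdeg, fun z hz => (hc z hz).1, fun z hz => (hc z hz).2⟩
  · exact (natDegree_add_C).le.trans hm
  · refine (isCoprime_iff_aeval_ne_zero_of_isAlgClosed ℂ ℂ _ _).2 fun w => ?_
    by_contra! h
    simp only [coe_aeval_eq_eval] at h
    refine hcB ⟨w, h.2, ?_⟩
    have := h.1
    rw [evA] at this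
    exact neg_eq_of_add_eq_zero_right this
  · simp [B, hn.ne]
  · intro j hj
    have h1 : (PowerSeries.mk (g δ c).coeff : PowerSeries ℂ) = (g δ c : PowerSeries ℂ) := by
      ext i
      simp
    have h2 : B δ * g δ c = A c - X ^ (n * N) * (A c * C ((-δ) ^ N)) := by
      have h3 := mul_neg_geom_sum (C (-δ) * X ^ n : ℂ[X]) N
      have h4 : B δ = 1 - C (-δ) * X ^ n := by simp [B]
      calc B δ * g δ c = A c * ((1 - C (-δ) * X ^ n) *
            ∑ l ∈ Finset.range N, (C (-δ) * X ^ n) ^ l) := by rw [h4]; ring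
        _ = _ := by rw [h3, mul_pow, ← pow_mul, ← C_pow]; ring
    have h5 : j < n * N := by nlinarith
    rw [h1, ← Polynomial.coe_mul, Polynomial.coeff_coe, h2, coeff_sub, coeff_X_pow_mul',
      if_neg (by omega), sub_zero]

lemma exists_mem_padeNearSet_near {Ω K L : Set ℂ} (hΩ : IsOpen Ω) (h0 : (0 : ℂ) ∈ Ω)
    (hsc : IsSimplyConnected Ω) (hK : IsCompact K) (hKΩ : K ⊆ Ω) (hL : IsCompact L)
    (hLΩ : L ⊆ Ω) {ε η : ℝ} (hε : 0 < ε) (hη : 0 < η) (f : Hol Ω) :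
    ∃ N : ℕ, ∀ m n : ℕ, N ≤ m → 0 < n →
      ∃ g ∈ padeNearSet Ω K η m n, ∀ z ∈ L, ‖g.1 z - f.1 z‖ < ε := by
  obtain ⟨p, hp⟩ := exists_polynomial_near_of_isSimplyConnected hΩ hsc hL hLΩ f.2.1 (half_pos hε)
  refine ⟨p.natDegree, fun m n hm hn => ?_⟩
  obtain ⟨g, A, B, hAB, hB, hg, hgAB⟩ :=
    exists_isPade_near p (hK.union hL) (half_pos hε) hη hm hn
  have hd := hankelDet_ne_zero_of_isPade hAB hB
  obtain ⟨h1, h2⟩ := eq_of_isPade hd hAB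
  refine ⟨polyHol Ω g, mem_padeNearSet.2 ?_, fun z hz => ?_⟩
  · rw [tc_polyHol hΩ h0]
    refine ⟨mem_Nset_iff.1 ⟨hd, A, B, hAB, hB⟩, fun z hz => ?_⟩
    rw [polyHol_apply g (hKΩ hz), h1, h2, eval_C_mul, eval_C_mul, mul_left_comm, ← mul_sub,
      norm_mul, norm_mul, mul_left_comm]
    have := norm_pos_iff.2 hd
    have := hgAB z (Or.inl hz)
    gcongr
  · rw [polyHol_apply g (hLΩ hz)]
    calc ‖g.eval z - f.1 z‖ ≤ ‖g.eval z - p.eval z‖ + ‖p.eval z - f.1 z‖ :=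
          norm_sub_le_norm_sub_add_norm_sub _ _ _
      _ < ε / 2 + ε / 2 := add_lt_add (hg z (Or.inr hz)) (hp z hz)
      _ = ε := add_halves ε

lemma dense_iUnion_padeNearSet {Ω K : Set ℂ} (hΩ : IsOpen Ω) (h0 : (0 : ℂ) ∈ Ω)
    (hsc : IsSimplyConnected Ω) (hK : IsCompact K) (hKΩ : K ⊆ Ω) {η : ℝ} (hη : 0 < η)
    {m n : ℕ → ℕ} (hn : ∀ k, 0 < n k) (hub : ∀ N : ℕ, ∃ k, N < m k) (j : ℕ) :
    Dense (⋃ k ≥ j, padeNearSet Ω K η (m k) (n k)) := by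
  intro f
  obtain ⟨E, hEmono, hEc, hEΩ, -, hE⟩ := exists_compact_exhaustion hΩ
  have h : ∀ i : ℕ, ∃ g ∈ ⋃ k ≥ j, padeNearSet Ω K η (m k) (n k),
      ∀ z ∈ E i, ‖g.1 z - f.1 z‖ < 1 / ((i : ℝ) + 1) := by
    intro i
    obtain ⟨N, hN⟩ := exists_mem_padeNearSet_near hΩ h0 hsc hK hKΩ (hEc i) (hEΩ i)
      (Nat.one_div_pos_of_nat (n := i)) hη f
    obtain ⟨k, hk⟩ := hub (N + ∑ l ∈ Finset.range j, m l)
    obtain ⟨g, hg, hgf⟩ := hN (m k) (n k) (by omega) (hn k)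
    refine ⟨g, Set.mem_iUnion₂.2 ⟨k, ?_, hg⟩, hgf⟩
    by_contra! hkj
    have := Finset.single_le_sum (f := m) (fun l _ => Nat.zero_le _) (Finset.mem_range.2 hkj)
    omega
  choose g hg hgf using h
  refine mem_closure_of_tendsto ((tendsto_hol_iff hΩ).2 ?_ : Tendsto g atTop (𝓝 f))
    (Eventually.of_forall hg)
  refine (tendstoLocallyUniformlyOn_iff_forall_isCompact hΩ).2 fun L hLΩ hL => ?_
  obtain ⟨i₀, hi₀⟩ := hE L hLΩ hL
  refine Metric.tendstoUniformlyOn_iff.2 fun ε hε => ?_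
  filter_upwards [eventually_ge_atTop i₀,
    tendsto_one_div_add_atTop_nhds_zero_nat.eventually_lt_const hε] with i hi hiε z hz
  rw [dist_comm, dist_eq_norm]
  exact (hgf i z (hEmono hi (hi₀ hz))).trans hiε

/-- Theorem 3.6 : for a simply connected domain `Ω ∋ 0` and a sequence `(m_k, n_k)_k`
of pairs of positive integers with `(m_k)_k` unbounded, the set of `f ∈ H(Ω)` for which
there is an infinite subsequence along which `f ∈ 𝒩_{m_k,n_k}` and the Padé
approximants `[f; m_k/n_k]` converge to `f` uniformly on every compact subset of `Ω`,
is a dense `G_δ` subset of `H(Ω)`. -/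
theorem stmt_7 (Ω : Set ℂ) (hΩo : IsOpen Ω) (hΩ0 : (0 : ℂ) ∈ Ω) (hΩc : IsConnected Ω)
    (hΩsc : SimplyConnectedSpace Ω)
    (m n : ℕ → ℕ) (hm : ∀ k, 0 < m k) (hn : ∀ k, 0 < n k)
    (hub : ∀ N : ℕ, ∃ k, N < m k) :
    IsGδ {f : Hol Ω | ∃ σ : ℕ → ℕ, StrictMono σ ∧
        ∃ P Q : ℕ → Polynomial ℂ,
          (∀ k, tc f.1 ∈ Nset (m (σ k)) (n (σ k)) ∧
            IsPade (tc f.1) (m (σ k)) (n (σ k)) (P k) (Q k)) ∧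
          TendstoLocallyUniformlyOn
            (fun k z => (P k).eval z / (Q k).eval z) f.1 atTop Ω} ∧
    Dense {f : Hol Ω | ∃ σ : ℕ → ℕ, StrictMono σ ∧
        ∃ P Q : ℕ → Polynomial ℂ,
          (∀ k, tc f.1 ∈ Nset (m (σ k)) (n (σ k)) ∧
            IsPade (tc f.1) (m (σ k)) (n (σ k)) (P k) (Q k)) ∧
          TendstoLocallyUniformlyOn
            (fun k z => (P k).eval z / (Q k).eval z) f.1 atTop Ω} := by
  obtain ⟨E, hEmono, hEc, hEΩ, hEint, hE⟩ := exists_compact_exhaustion hΩo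
  set U : ℕ → ℕ → Set (Hol Ω) := fun j k =>
    padeNearSet Ω (E j) (1 / ((j : ℝ) + 1)) (m k) (n k) with hU
  have hpos : ∀ j : ℕ, (0 : ℝ) < 1 / ((j : ℝ) + 1) := fun j => Nat.one_div_pos_of_nat
  have hopen : ∀ j, IsOpen (⋃ k ≥ j, U j k) := fun j =>
    isOpen_biUnion fun k _ => isOpen_padeNearSet hΩo hΩ0 (hEc j) (hEΩ j) _ _ _
  have hdense : ∀ j, Dense (⋃ k ≥ j, U j k) := fun j =>
    dense_iUnion_padeNearSet hΩo hΩ0 hΩsc (hEc j) (hEΩ j) (hpos j) hn hub j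
  have := baireSpace_hol hΩo
  have key := And.intro (IsGδ.iInter_of_isOpen hopen) (dense_iInter_of_isOpen hopen hdense)
  convert key using 2
  all_goals
    ext f
    simp only [Set.mem_ofPred_eq, Set.mem_iInter, Set.mem_iUnion, exists_prop]
    constructor
    · rintro ⟨σ, hσ, P, Q, hPQ, hlim⟩ j
      obtain ⟨k, hk, hkj⟩ := ((exists_mem_padeNearSet hΩo (hEΩ (j + 1)) (hEint j) (hEc (j + 1))
        (hpos j) hPQ hlim).and (eventually_ge_atTop j)).exists
      exact ⟨σ k, hkj.trans hσ.le_apply, hk⟩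
    · intro h
      choose κ hκ hfκ using h
      obtain ⟨φ, hφ, hκφ⟩ := strictMono_subseq_of_tendsto_atTop (tendsto_atTop_mono hκ tendsto_id)
      refine ⟨κ ∘ φ, hκφ, _, _, fun i => ⟨mem_Nset_iff.2 (hfκ (φ i)).1,
        isPade_of_hankelDet_ne_zero (hfκ (φ i)).1.1⟩, ?_⟩
      refine (tendstoLocallyUniformlyOn_iff_forall_isCompact hΩo).2 fun L hLΩ hL => ?_
      obtain ⟨i₀, hi₀⟩ := hE L hLΩ hL
      refine Metric.tendstoUniformlyOn_iff.2 fun ε hε => ?_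
      filter_upwards [hφ.tendsto_atTop.eventually (eventually_ge_atTop i₀),
        hφ.tendsto_atTop.eventually
          (tendsto_one_div_add_atTop_nhds_zero_nat.eventually_lt_const hε)] with i hi hiε z hz
      exact (dist_div_lt_of_mem_padeNearSet (hpos _).le (hfκ (φ i))
        (hEmono hi (hi₀ hz))).trans hiε

end
end
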